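/- For every integer d ≥ n−1, the rank of the d-th order blow-up of the matrix representation satisfies the min-max relation rank A^{(d)} = d · min{dim S + dim T : (S, T) a nested 2-cover for ℓ_1,…,ℓ_m}. (Equivalently, the non-commutative rank of A equals the minimum of dim S + dim T over all nested 2-covers.) -/

import Mathlib

open Matrix

noncomputable section

/-- Wedge product `a ∧ b = a bᵀ − b aᵀ`. -/
def wedge {K : Type*} [Field K] {n : ℕ} (a b : Fin n → K) : Matrix (Fin n) (Fin n) K :=
  vecMulVec a b - vecMulVec b a

/-- The line spanned by `a` and `b`. -/
def line {K : Type*} [Field K] {n : ℕ} (a b : Fin n → K) : Submodule K (Fin n → K) :=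
  Submodule.span K {a, b}

/-- `y` is a fractional matroid matching for the lines `ℓᵢ = span {aᵢ, bᵢ}`:
`y ≥ 0` and `∑ᵢ dim(S ⊓ ℓᵢ) yᵢ ≤ dim S` for every subspace `S`. -/
def IsFracMatching {K : Type*} [Field K] {n m : ℕ} (a b : Fin m → Fin n → K)
    (y : Fin m → ℝ) : Prop :=
  (∀ i, 0 ≤ y i) ∧ ∀ S : Submodule K (Fin n → K),
    ∑ i, (Module.finrank K ↥(S ⊓ line (a i) (b i)) : ℝ) * y i ≤ (Module.finrank K ↥S : ℝ)

/-- The rational function field generated over `K` by the entries of the `d × d`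
indeterminate matrices `X₁, …, X_m`. -/
abbrev FF (K : Type*) [Field K] (m d : ℕ) : Type _ :=
  FractionRing (MvPolynomial (Fin m × Fin d × Fin d) K)

def toFF (K : Type*) [Field K] (m d : ℕ) : K →+* FF K m d :=
  (algebraMap (MvPolynomial (Fin m × Fin d × Fin d) K) (FF K m d)).comp MvPolynomial.C

/-- The `d`-th order blow-up `A^{(d)} = ∑ᵢ Xᵢ ⊗ (aᵢ ∧ bᵢ)` of the matrix
representation `A = ∑ᵢ xᵢ (aᵢ ∧ bᵢ)`. -/
def blowup {K : Type*} [Field K] {n m : ℕ} (a b : Fin m → Fin n → K) (d : ℕ) :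
    Matrix (Fin d × Fin n) (Fin d × Fin n) (FF K m d) :=
  ∑ i : Fin m,
    kroneckerMap (· * ·)
      (Matrix.of fun p q : Fin d =>
        algebraMap (MvPolynomial (Fin m × Fin d × Fin d) K) (FF K m d) (MvPolynomial.X (i, p, q)))
      ((wedge (a i) (b i)).map (toFF K m d))

section RankSpecialization

theorem Matrix.exists_linearIndependent_row_submatrix {F ι κ : Type*} [Field F] [Fintype ι]
    [Fintype κ] (N : Matrix ι κ F) :
    ∃ e : Fin N.rank → ι, LinearIndependent F (N.submatrix e id).row := by
  obtain ⟨f, hf, -, hli⟩ := Submodule.exists_fun_fin_finrank_span_eq F (Set.range N.row)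
  choose e he using hf
  refine ⟨fun i => e (Fin.cast (rank_eq_finrank_span_row N) i), ?_⟩
  have : (N.submatrix (fun i => e (Fin.cast (rank_eq_finrank_span_row N) i)) id).row =
      f ∘ Fin.cast (rank_eq_finrank_span_row N) := by
    ext i j
    exact congrFun (he _) j
  rw [this]
  exact hli.comp _ (Fin.cast_injective _)

theorem Matrix.exists_submatrix_det_ne_zero {F ι κ : Type*} [Field F] [Fintype ι] [Fintype κ]
    (N : Matrix ι κ F) :
    ∃ (e : Fin N.rank → ι) (f : Fin N.rank → κ), (N.submatrix e f).det ≠ 0 := by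
  obtain ⟨e, he⟩ := N.exists_linearIndependent_row_submatrix
  have hr : ((N.submatrix e id)ᵀ).rank = N.rank := by
    rw [rank_transpose, he.rank_matrix, Fintype.card_fin]
  have hc := ((N.submatrix e id)ᵀ).exists_linearIndependent_row_submatrix
  rw [hr] at hc
  obtain ⟨f, hf⟩ := hc
  refine ⟨e, f, ?_⟩
  rw [← det_transpose, ← isUnit_iff_ne_zero, ← isUnit_iff_isUnit_det,
    ← linearIndependent_rows_iff_isUnit]
  exact hf

theorem Matrix.le_rank_of_submatrix_det_ne_zero {F ι κ : Type*} [Field F] [Fintype κ]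
    (N : Matrix ι κ F) {k : ℕ} (e : Fin k → ι) (f : Fin k → κ)
    (h : (N.submatrix e f).det ≠ 0) : k ≤ N.rank := by
  simpa [rank_of_det_ne_zero h] using rank_submatrix_le N e f

/-- Specialization does not increase the rank. -/
theorem Matrix.rank_map_le_rank_map {R F L ι κ : Type*} [CommRing R] [Field F] [Field L]
    [Fintype ι] [Fintype κ] (N : Matrix ι κ R) (φ : R →+* F) (ψ : R →+* L)
    (hψ : Function.Injective ψ) : (N.map φ).rank ≤ (N.map ψ).rank := by
  obtain ⟨e, f, h⟩ := (N.map φ).exists_submatrix_det_ne_zero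
  refine le_rank_of_submatrix_det_ne_zero _ e f ?_
  rw [submatrix_map, ← RingHom.mapMatrix_apply, ← RingHom.map_det] at h ⊢
  rw [map_ne_zero_iff _ hψ]
  exact fun h0 => h (by rw [h0, map_zero])

/-- Over an infinite field, finitely many polynomial matrices can be specialized simultaneously
without any loss of rank. -/
theorem Matrix.exists_le_rank_map_aeval {K F τ α ι κ : Type*} [Field K] [Field F] [Algebra K F]
    [Infinite F] [Fintype α] [Fintype ι] [Fintype κ] (s : α → Set ι)
    (N : Matrix ι κ (MvPolynomial τ K)) :
    ∃ x : τ → F, ∀ a, ((N.submatrix (Subtype.val : s a → ι) id).map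
        (algebraMap _ (FractionRing (MvPolynomial τ K)))).rank ≤
      ((N.submatrix (Subtype.val : s a → ι) id).map (MvPolynomial.aeval x)).rank := by
  classical
  choose e f h using fun a => ((N.submatrix (Subtype.val : s a → ι) id).map
        (algebraMap _ (FractionRing (MvPolynomial τ K)))).exists_submatrix_det_ne_zero
  simp only [submatrix_map, ← RingHom.mapMatrix_apply, ← RingHom.map_det] at h
  have h' : ∀ a, ((N.submatrix (Subtype.val : s a → ι) id).submatrix (e a) (f a)).det ≠ 0 :=
    fun a h0 => h a (by rw [h0, map_zero])
  have hprod := Finset.prod_ne_zero_iff.2 fun a (_ : a ∈ Finset.univ) => h' a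
  have hmap := (map_ne_zero_iff _
    (MvPolynomial.map_injective (algebraMap K F) (algebraMap K F).injective)).2 hprod
  obtain ⟨x, hx⟩ : ∃ x : τ → F, MvPolynomial.eval x (MvPolynomial.map (algebraMap K F)
      (∏ a, ((N.submatrix (Subtype.val : s a → ι) id).submatrix (e a) (f a)).det)) ≠ 0 := by
    by_contra! hc
    exact hmap (MvPolynomial.funext fun x => by rw [hc x, map_zero])
  refine ⟨x, fun a => le_rank_of_submatrix_det_ne_zero _ (e a) (f a) ?_⟩
  rw [MvPolynomial.eval_map, ← MvPolynomial.aeval_def, map_prod, Finset.prod_ne_zero_iff] at hx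
  have := hx a (Finset.mem_univ a)
  rwa [submatrix_map, ← AlgHom.coe_toRingHom, ← RingHom.mapMatrix_apply, ← RingHom.map_det]

end RankSpecialization

section GenericRank

variable {K : Type*} [Field K] {μ ι : Type*} [Fintype μ]

/-- The matrix `∑ᵢ Xᵢ ⊗ Aᵢ` over an extension field. -/
def kronSum {F : Type*} [Field F] [Algebra K F] {p q : Type*} (A : μ → Matrix ι ι K)
    (X : μ → Matrix p q F) : Matrix (p × ι) (q × ι) F :=
  ∑ i, kroneckerMap (· * ·) (X i) ((A i).map (algebraMap K F))

theorem kronSum_apply {F : Type*} [Field F] [Algebra K F] {p q : Type*} (A : μ → Matrix ι ι K)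
    (X : μ → Matrix p q F) (x : p × ι) (y : q × ι) :
    kronSum A X x y = ∑ i, X i x.1 y.1 * algebraMap K F (A i x.2 y.2) := by
  simp [kronSum, Matrix.sum_apply]

/-- The matrix `∑ᵢ Xᵢ ⊗ Aᵢ` for matrices `Xᵢ` of indeterminates. -/
def genericKronSum (p q : Type*) (A : μ → Matrix ι ι K) :
    Matrix (p × ι) (q × ι) (MvPolynomial (μ × p × q) K) :=
  of fun x y => ∑ i, MvPolynomial.X (i, x.1, y.1) * MvPolynomial.C (A i x.2 y.2)

theorem genericKronSum_map_aeval {F : Type*} [Field F] [Algebra K F] (p q : Type*)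
    (A : μ → Matrix ι ι K) (x : μ × p × q → F) :
    (genericKronSum p q A).map (MvPolynomial.aeval x) =
      kronSum A fun i => of fun k l => x (i, k, l) := by
  ext u v
  simp [genericKronSum, kronSum_apply]

variable [Fintype ι]

/-- The generic rank of `∑ᵢ Xᵢ ⊗ Aᵢ` with `Xᵢ` of size `p × q`. -/
def genRank (A : μ → Matrix ι ι K) (p q : ℕ) : ℕ :=
  ((genericKronSum (Fin p) (Fin q) A).map
      (algebraMap _ (FractionRing (MvPolynomial (μ × Fin p × Fin q) K)))).rank

theorem genRank_eq_rank_kronSum (A : μ → Matrix ι ι K) (p q : ℕ) :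
    genRank A p q = (kronSum A fun i => of fun (k : Fin p) (l : Fin q) =>
      algebraMap (MvPolynomial (μ × Fin p × Fin q) K)
        (FractionRing (MvPolynomial (μ × Fin p × Fin q) K)) (MvPolynomial.X (i, k, l))).rank := by
  rw [genRank]
  congr 1
  ext u v
  simp [genericKronSum, kronSum_apply, IsScalarTower.algebraMap_apply K
    (MvPolynomial (μ × Fin p × Fin q) K) (FractionRing (MvPolynomial (μ × Fin p × Fin q) K)),
    MvPolynomial.algebraMap_eq, -MvPolynomial.algebraMap_apply]

theorem rank_kronSum_le_genRank {F : Type*} [Field F] [Algebra K F] {p q : Type*} [Fintype p]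
    [Fintype q] (A : μ → Matrix ι ι K) (X : μ → Matrix p q F) :
    (kronSum A X).rank ≤ genRank A (Fintype.card p) (Fintype.card q) := by
  classical
  let ep := Fintype.equivFin p
  let eq := Fintype.equivFin q
  have h1 := (genericKronSum (Fin (Fintype.card p)) (Fin (Fintype.card q)) A).rank_map_le_rank_map
    (MvPolynomial.aeval fun t => X t.1 (ep.symm t.2.1) (eq.symm t.2.2)).toRingHom
    (algebraMap _ (FractionRing (MvPolynomial (μ × Fin (Fintype.card p) × Fin (Fintype.card q)) K)))
    (IsFractionRing.injective _ _)
  refine le_trans (le_of_eq ?_) h1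
  rw [AlgHom.toRingHom_eq_coe, AlgHom.coe_toRingHom, genericKronSum_map_aeval]
  rw [← rank_submatrix _ (ep.prodCongr (Equiv.refl ι)) (eq.prodCongr (Equiv.refl ι))]
  congr 1
  ext u v
  simp [kronSum_apply]

/-- The `ι`-block of `∑ᵢ Xᵢ ⊗ Aᵢ` belonging to one row `y` of the tuple `X`. -/
def blockRow {F : Type*} [Field F] [Algebra K F] {q : Type*} [Fintype q] (A : μ → Matrix ι ι K)
    (y : μ → q → F) : (q × ι → F) →ₗ[F] (ι → F) :=
  (of fun a (v : q × ι) => ∑ i, y i v.1 * algebraMap K F (A i a v.2)).mulVecLin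

theorem blockRow_apply {F : Type*} [Field F] [Algebra K F] {q : Type*} [Fintype q]
    (A : μ → Matrix ι ι K) (y : μ → q → F) (x : q × ι → F) :
    blockRow A y x = ∑ l, ∑ i, y i l • ((A i).map (algebraMap K F)) *ᵥ fun b => x (l, b) := by
  ext a
  simp only [blockRow, mulVecLin_apply, mulVec, dotProduct, of_apply, Fintype.sum_prod_type,
    Finset.sum_apply, Pi.smul_apply, smul_eq_mul, map_apply, Finset.sum_mul, Finset.mul_sum]
  refine Finset.sum_congr rfl fun l _ => ?_
  rw [Finset.sum_comm]
  simp [mul_assoc]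

theorem blockRow_add_smul {F : Type*} [Field F] [Algebra K F] {q : Type*} [Fintype q]
    (A : μ → Matrix ι ι K) (y z : μ → q → F) (s : F) :
    blockRow A (y + s • z) = blockRow A y + s • blockRow A z := by
  ext x a
  simp [blockRow_apply, add_smul, Finset.sum_add_distrib, Finset.smul_sum, mul_assoc]

theorem ker_mulVecLin_kronSum {F : Type*} [Field F] [Algebra K F] {p q : Type*} [Fintype q]
    (A : μ → Matrix ι ι K) (X : μ → Matrix p q F) :
    LinearMap.ker (kronSum A X).mulVecLin =
      ⨅ k, LinearMap.ker (blockRow A fun i => X i k) := by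
  ext x
  simp only [LinearMap.mem_ker, Submodule.mem_iInf, mulVecLin_apply, funext_iff, blockRow,
    Prod.forall, mulVec, dotProduct, kronSum_apply, of_apply]
  rfl

theorem finrank_ker_add_rank {F ι κ : Type*} [Field F] [Fintype κ] (N : Matrix ι κ F) :
    Module.finrank F (LinearMap.ker N.mulVecLin) + N.rank = Fintype.card κ := by
  rw [add_comm, Matrix.rank, LinearMap.finrank_range_add_finrank_ker,
    Module.finrank_fintype_fun_eq_card]

theorem card_mul_card_le_finrank_iInf_ker_blockRow {F : Type*} [Field F] [Algebra K F]
    {p q : Type*} [Fintype p] [Fintype q] (A : μ → Matrix ι ι K) (X : μ → Matrix p q F) :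
    Fintype.card q * Fintype.card ι ≤
      Module.finrank F (⨅ k, LinearMap.ker (blockRow A fun i => X i k) : Submodule F (q × ι → F)) +
      genRank A (Fintype.card p) (Fintype.card q) := by
  rw [← ker_mulVecLin_kronSum, ← Fintype.card_prod, ← finrank_ker_add_rank (kronSum A X)]
  exact Nat.add_le_add_left (rank_kronSum_le_genRank A X) _

/-- Over an infinite field there are matrices `Xᵢ` attaining the generic rank simultaneously for
all subsets of the rows. -/
theorem exists_finrank_iInf_ker_blockRow (F : Type*) [Field F] [Algebra K F] [Infinite F]
    (A : μ → Matrix ι ι K) (p q : ℕ) :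
    ∃ X : μ → Matrix (Fin p) (Fin q) F, ∀ P : Finset (Fin p),
      Module.finrank F
        (⨅ k ∈ P, LinearMap.ker (blockRow A fun i => X i k) : Submodule F (Fin q × ι → F)) +
      genRank A P.card q = q * Fintype.card ι := by
  classical
  obtain ⟨x, hx⟩ := Matrix.exists_le_rank_map_aeval (F := F)
    (fun P : Finset (Fin p) => {u : Fin p × ι | u.1 ∈ P}) (genericKronSum (Fin p) (Fin q) A)
  refine ⟨fun i => of fun k l => x (i, k, l), fun P => ?_⟩
  let X' : μ → Matrix P (Fin q) F := fun i => of fun k l => x (i, k.1, l)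
  let e : P × ι ≃ {u : Fin p × ι | u.1 ∈ P} :=
    { toFun := fun u => ⟨(u.1.1, u.2), u.1.2⟩
      invFun := fun u => (⟨u.1.1, u.2⟩, u.1.2)
      left_inv := fun _ => rfl
      right_inv := fun _ => rfl }
  have hle : genRank A P.card q ≤ (kronSum A X').rank := by
    have h2 : (kronSum A X').rank = (((genericKronSum (Fin p) (Fin q) A).submatrix
        (Subtype.val : {u : Fin p × ι | u.1 ∈ P} → _) id).map (MvPolynomial.aeval x)).rank := by
      rw [← submatrix_map, genericKronSum_map_aeval, ← rank_submatrix _ e (Equiv.refl _)]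
      congr 1
      ext u v
      simp [kronSum_apply, X', e]
    rw [h2]
    refine le_trans ?_ (hx P)
    let g := P.equivFin
    have h3 := ((genericKronSum (Fin p) (Fin q) A).submatrix
      (Subtype.val : {u : Fin p × ι | u.1 ∈ P} → _) id).rank_map_le_rank_map
      (MvPolynomial.aeval fun t : μ × Fin p × Fin q => if h : t.2.1 ∈ P then
        algebraMap (MvPolynomial (μ × Fin P.card × Fin q) K)
        (FractionRing (MvPolynomial (μ × Fin P.card × Fin q) K))
          (MvPolynomial.X (t.1, g ⟨t.2.1, h⟩, t.2.2)) else 0).toRingHom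
      (algebraMap _ (FractionRing (MvPolynomial (μ × Fin p × Fin q) K)))
      (IsFractionRing.injective _ _)
    refine le_trans (le_of_eq ?_) h3
    rw [AlgHom.toRingHom_eq_coe, AlgHom.coe_toRingHom, ← submatrix_map, genericKronSum_map_aeval,
      genRank_eq_rank_kronSum,
      ← rank_submatrix _ ((g.symm.prodCongr (Equiv.refl ι)).trans e) (Equiv.refl _)]
    congr 1
    ext u v
    simp [kronSum_apply, e]
  have hge := rank_kronSum_le_genRank A X'
  rw [Fintype.card_coe, Fintype.card_fin] at hge
  have hk := finrank_ker_add_rank (kronSum A X')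
  rw [ker_mulVecLin_kronSum, Fintype.card_prod, Fintype.card_fin, le_antisymm hge hle] at hk
  rw [iInf_subtype']
  exact hk

end GenericRank

section RankCalculus

variable {K : Type*} [Field K] {μ ι : Type*} [Fintype μ] [Fintype ι]

theorem genRank_le_right (A : μ → Matrix ι ι K) (p q : ℕ) :
    genRank A p q ≤ q * Fintype.card ι := by
  simpa [genRank, Fintype.card_prod] using
    rank_le_card_width ((genericKronSum (Fin p) (Fin q) A).map
      (algebraMap _ (FractionRing (MvPolynomial (μ × Fin p × Fin q) K))))

theorem genRank_zero_left (A : μ → Matrix ι ι K) (q : ℕ) : genRank A 0 q = 0 := by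
  simpa [genRank, Fintype.card_prod] using
    rank_le_card_height ((genericKronSum (Fin 0) (Fin q) A).map
      (algebraMap _ (FractionRing (MvPolynomial (μ × Fin 0 × Fin q) K))))

theorem genRank_le_comm {A : μ → Matrix ι ι K} (hA : ∀ i, (A i)ᵀ = -A i) (p q : ℕ) :
    genRank A p q ≤ genRank A q p := by
  rw [genRank_eq_rank_kronSum, ← rank_transpose]
  set L := FractionRing (MvPolynomial (μ × Fin p × Fin q) K)
  set X : μ → Matrix (Fin p) (Fin q) L := fun i => of fun k l =>
    algebraMap (MvPolynomial (μ × Fin p × Fin q) K) L (MvPolynomial.X (i, k, l))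
  have h : (kronSum A X)ᵀ = kronSum A fun i => -(X i)ᵀ := by
    ext u v
    simp only [transpose_apply, kronSum_apply]
    refine Finset.sum_congr rfl fun i _ => ?_
    have := congrFun (congrFun (hA i) u.2) v.2
    rw [transpose_apply, neg_apply] at this
    rw [this, map_neg, mul_neg]
    exact (neg_mul _ _).symm
  rw [h]
  simpa using rank_kronSum_le_genRank A fun i => -(X i)ᵀ

theorem genRank_comm {A : μ → Matrix ι ι K} (hA : ∀ i, (A i)ᵀ = -A i) (p q : ℕ) :
    genRank A p q = genRank A q p :=
  le_antisymm (genRank_le_comm hA p q) (genRank_le_comm hA q p)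

theorem genRank_add_genRank_le (A : μ → Matrix ι ι K) (p q : ℕ) :
    genRank A p q + genRank A (p + 2) q ≤ 2 * genRank A (p + 1) q := by
  classical
  have : Infinite (FractionRing (Polynomial K)) :=
    Infinite.of_injective _ (IsFractionRing.injective (Polynomial K) (FractionRing (Polynomial K)))
  obtain ⟨X, hX⟩ := exists_finrank_iInf_ker_blockRow (FractionRing (Polynomial K)) A (p + 2) q
  let P : Finset (Fin (p + 2)) := {i | i.1 < p}
  have hP : P.card = p := by simp [P, Fin.card_filter_val_lt]
  let a : Fin (p + 2) := ⟨p, by omega⟩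
  let b : Fin (p + 2) := ⟨p + 1, by omega⟩
  have ha : a ∉ P := by simp [P, a]
  have hb : b ∉ P := by simp [P, b]
  have hab : a ∉ insert b P := by simp [ha, a, b]
  have h0 := hX P
  have h1 := hX (insert a P)
  have h2 := hX (insert b P)
  have h3 := hX (insert a (insert b P))
  rw [Finset.card_insert_of_notMem ha, hP, Finset.iInf_insert] at h1
  rw [Finset.card_insert_of_notMem hb, hP, Finset.iInf_insert] at h2
  rw [Finset.card_insert_of_notMem hab, Finset.card_insert_of_notMem hb, hP, Finset.iInf_insert,
    Finset.iInf_insert] at h3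
  rw [hP] at h0
  set κ := fun k => LinearMap.ker (blockRow A fun i => X i k)
  set κP := ⨅ k ∈ P, κ k
  have hsum := Submodule.finrank_sup_add_finrank_inf_eq (κ a ⊓ κP) (κ b ⊓ κP)
  have hle := Submodule.finrank_mono (sup_le (inf_le_right : κ a ⊓ κP ≤ κP)
    (inf_le_right : κ b ⊓ κP ≤ κP))
  have hinf : κ a ⊓ κP ⊓ (κ b ⊓ κP) = κ a ⊓ (κ b ⊓ κP) := by
    rw [inf_assoc, inf_left_comm κP, inf_idem]
  rw [hinf] at hsum
  change Module.finrank _ ↥κP + _ = _ at h0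
  change Module.finrank _ ↥(κ a ⊓ κP) + _ = _ at h1
  change Module.finrank _ ↥(κ b ⊓ κP) + _ = _ at h2
  change Module.finrank _ ↥(κ a ⊓ (κ b ⊓ κP)) + _ = _ at h3
  rw [add_assoc p 1 1] at h3
  norm_num at h3
  omega

theorem two_mul_genRank_le (A : μ → Matrix ι ι K) (p q : ℕ) :
    2 * genRank A p q ≤ genRank A (2 * p) (2 * q) := by
  classical
  have hg := genRank_eq_rank_kronSum A p q
  set L := FractionRing (MvPolynomial (μ × Fin p × Fin q) K)
  set X : μ → Matrix (Fin p) (Fin q) L := fun i => of fun k l =>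
    algebraMap (MvPolynomial (μ × Fin p × Fin q) K) L (MvPolynomial.X (i, k, l))
  have hc := (kronSum A X).exists_submatrix_det_ne_zero
  rw [← hg] at hc
  obtain ⟨e, f, hef⟩ := hc
  have h := rank_kronSum_le_genRank A fun i => fromBlocks (X i) 0 0 (X i)
  have hle := rank_submatrix_le (kronSum A fun i => fromBlocks (X i) 0 0 (X i))
    (Sum.elim (fun i => (Sum.inl (e i).1, (e i).2)) fun i => (Sum.inr (e i).1, (e i).2))
    (Sum.elim (fun i => (Sum.inl (f i).1, (f i).2)) fun i => (Sum.inr (f i).1, (f i).2))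
  have heq : (kronSum A fun i => fromBlocks (X i) 0 0 (X i)).submatrix
    (Sum.elim (fun i => (Sum.inl (e i).1, (e i).2)) fun i => (Sum.inr (e i).1, (e i).2))
    (Sum.elim (fun i => (Sum.inl (f i).1, (f i).2)) fun i => (Sum.inr (f i).1, (f i).2)) =
    fromBlocks ((kronSum A X).submatrix e f) 0 0 ((kronSum A X).submatrix e f) := by
    ext (u | u) (v | v) <;> simp [kronSum_apply]
  rw [heq, rank_of_det_ne_zero (by rw [det_fromBlocks_zero₂₁]; exact mul_ne_zero hef hef)] at hle
  simp only [Fintype.card_sum, Fintype.card_fin, ← two_mul] at h hle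
  exact hle.trans h

theorem two_le_genRank_one_one {A : μ → Matrix ι ι K} (hA : ∀ i, (A i)ᵀ = -A i)
    (hdiag : ∀ i a, A i a a = 0) (i : μ) (hi : A i ≠ 0) : 2 ≤ genRank A 1 1 := by
  classical
  obtain ⟨a, b, hab⟩ : ∃ a b, A i a b ≠ 0 := by
    by_contra! h
    exact hi (by ext a b; exact h a b)
  refine le_trans ?_ (rank_kronSum_le_genRank A fun j => of fun (_ _ : Fin 1) =>
    if j = i then (1 : K) else 0)
  refine le_rank_of_submatrix_det_ne_zero _ (fun k => (0, ![a, b] k)) (fun k => (0, ![a, b] k)) ?_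
  have hba : A i b a = - A i a b := congrFun (congrFun (hA i) a) b
  simpa [det_fin_two, kronSum_apply, hdiag, hba] using hab

/-- A concave sequence starting at zero lies above its chords. -/
theorem mul_le_succ_mul_of_concave {f : ℕ → ℕ} (h0 : f 0 = 0)
    (hf : ∀ p, f p + f (p + 2) ≤ 2 * f (p + 1)) (k : ℕ) : k * f (k + 1) ≤ (k + 1) * f k := by
  induction k with
  | zero => simp [h0]
  | succ k ih => nlinarith [hf k, ih]

theorem le_mul_of_concave {f : ℕ → ℕ} (h0 : f 0 = 0)
    (hf : ∀ p, f p + f (p + 2) ≤ 2 * f (p + 1)) (k : ℕ) : f k ≤ k * f 1 := by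
  induction k with
  | zero => simp [h0]
  | succ k ih =>
    rcases Nat.eq_zero_or_pos k with rfl | hk
    · simp
    · have := mul_le_succ_mul_of_concave h0 hf k
      nlinarith

theorem add_mul_le_of_concave {f : ℕ → ℕ} (hf : ∀ p, f p + f (p + 2) ≤ 2 * f (p + 1)) {k c : ℕ}
    (hc : f k + c ≤ f (k + 1)) {j : ℕ} (hj : j ≤ k) : f j + (k - j) * c ≤ f k := by
  have key : ∀ i ≤ k, f (k - i) + c ≤ f (k - i + 1) ∧ f (k - i) + i * c ≤ f k := by
    intro i
    induction i with
    | zero => simpa using hc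
    | succ i ih =>
      intro hi
      obtain ⟨h1, h2⟩ := ih (by omega)
      have h3 := hf (k - (i + 1))
      have e1 : k - (i + 1) + 1 = k - i := by omega
      have e2 : k - (i + 1) + 2 = k - i + 1 := by omega
      rw [e1, e2] at h3
      rw [e1, add_mul]
      constructor <;> omega
  have := (key (k - j) (by omega)).2
  rwa [Nat.sub_sub_self hj] at this

end RankCalculus

section Regularity

/-- A semilinear endomorphism over `Frac(B[X])` whose `d`-th power is multiplication by `X` exists
only in dimensions divisible by `d`. -/
theorem dvd_finrank_of_iterate_eq_smul {B : Type*} [CommRing B] [IsDomain B] (τ : B →+* B)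
    (hτ : Function.Injective τ) {Φ : Type*} [Field Φ] [Algebra (Polynomial B) Φ]
    [IsFractionRing (Polynomial B) Φ] (σ : Φ →+* Φ)
    (hσ : ∀ p : Polynomial B, σ (algebraMap _ Φ p) = algebraMap _ Φ (p.map τ))
    {W : Type*} [AddCommGroup W] [Module Φ W] [FiniteDimensional Φ W] (T : W →+ W)
    (hT : ∀ (c : Φ) w, T (c • w) = σ c • T w) {d : ℕ} (hd : 1 ≤ d)
    (hTd : ∀ w, T^[d] w = algebraMap (Polynomial B) Φ Polynomial.X • w) :
    d ∣ Module.finrank Φ W := by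
  classical
  set k := Module.finrank Φ W
  let b := Module.finBasis Φ W
  let M : Matrix (Fin k) (Fin k) Φ := of fun i j => b.repr (T (b j)) i
  have hM : ∀ j, T (b j) = ∑ i, M i j • b i := fun j => (b.sum_repr (T (b j))).symm
  let C : ℕ → Matrix (Fin k) (Fin k) Φ := fun j =>
    Nat.rec 1 (fun _ C => M * C.map σ) j
  have hC : ∀ j l, T^[j] (b l) = ∑ i, C j i l • b i := by
    intro j l
    induction j with
    | zero => simp [C, one_apply]
    | succ j ih =>
      rw [Function.iterate_succ_apply', ih, map_sum]
      simp_rw [hT, hM, Finset.smul_sum, smul_smul]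
      rw [Finset.sum_comm]
      refine Finset.sum_congr rfl fun i _ => ?_
      rw [← Finset.sum_smul]
      congr 1
      simp [C, mul_apply, mul_comm]
  have hCd : C d = algebraMap (Polynomial B) Φ Polynomial.X • (1 : Matrix (Fin k) (Fin k) Φ) := by
    ext i l
    have h := (hC d l).symm.trans (hTd (b l))
    have h2 := congrArg (fun w => b.repr w i) h
    simpa [Finsupp.single_apply, one_apply, eq_comm, Algebra.algebraMap_eq_smul_one] using h2
  have hz : (algebraMap (Polynomial B) Φ Polynomial.X) ≠ 0 := by
    rw [map_ne_zero_iff _ (IsFractionRing.injective _ _)]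
    exact Polynomial.X_ne_zero
  have hdet : (C d).det = algebraMap (Polynomial B) Φ (Polynomial.X ^ k) := by
    rw [hCd, det_smul]
    simp
  have hsucc : ∀ j, (C (j + 1)).det = M.det * σ (C j).det := by
    intro j
    rw [RingHom.map_det, ← det_mul]
    rfl
  obtain ⟨p, q, hq, hpq⟩ := IsFractionRing.div_surjective (A := Polynomial B) M.det
  have hq0 := nonZeroDivisors.ne_zero hq
  have hqΦ : algebraMap (Polynomial B) Φ q ≠ 0 := by
    rwa [map_ne_zero_iff _ (IsFractionRing.injective _ _)]
  have hp0 : p ≠ 0 := by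
    rintro rfl
    obtain ⟨e, rfl⟩ : ∃ e, d = e + 1 := ⟨d - 1, by omega⟩
    rw [hsucc, ← hpq] at hdet
    simp only [map_zero, zero_div, zero_mul, map_pow] at hdet
    exact pow_ne_zero k hz hdet.symm
  have key : ∀ j, ∃ P Q : Polynomial B, P ≠ 0 ∧ Q ≠ 0 ∧ P.natDegree = j * p.natDegree ∧
      Q.natDegree = j * q.natDegree ∧
      algebraMap _ Φ Q * (C j).det = algebraMap _ Φ P := by
    intro j
    induction j with
    | zero => exact ⟨1, 1, by simp [C]⟩
    | succ j ih =>
      obtain ⟨P, Q, hP, hQ, hPd, hQd, h⟩ := ih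
      have hP' : P.map τ ≠ 0 := (Polynomial.map_ne_zero_iff hτ).2 hP
      have hQ' : Q.map τ ≠ 0 := (Polynomial.map_ne_zero_iff hτ).2 hQ
      refine ⟨p * P.map τ, q * Q.map τ, mul_ne_zero hp0 hP', mul_ne_zero hq0 hQ', ?_, ?_, ?_⟩
      · rw [Polynomial.natDegree_mul hp0 hP', Polynomial.natDegree_map_eq_of_injective hτ, hPd]
        ring
      · rw [Polynomial.natDegree_mul hq0 hQ', Polynomial.natDegree_map_eq_of_injective hτ, hQd]
        ring
      · rw [hsucc, ← hpq, map_mul, map_mul, ← hσ, ← hσ, ← h, map_mul]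
        field_simp
  obtain ⟨P, Q, hP, hQ, hPd, hQd, h⟩ := key d
  rw [hdet, ← map_mul] at h
  have h1 := congrArg Polynomial.natDegree (IsFractionRing.injective (Polynomial B) Φ h)
  rw [Polynomial.natDegree_mul hQ (pow_ne_zero _ Polynomial.X_ne_zero), Polynomial.natDegree_X_pow,
    hPd, hQd] at h1
  exact (Nat.dvd_add_right (dvd_mul_right d _)).1 (h1 ▸ dvd_mul_right d _)

variable {d : ℕ} [NeZero d] {Φ ι : Type*} [Field Φ]

/-- The cyclic shift by one block, twisted by `σ` and by `z` in the first block. -/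
def cyclicTwist (d : ℕ) [NeZero d] (ι : Type*) (σ : Φ →+* Φ) (z : Φ) :
    (Fin d × ι → Φ) →+ (Fin d × ι → Φ) where
  toFun v u := (if u.1 = 0 then z else 1) * σ (v (u.1 - 1, u.2))
  map_zero' := by ext; simp
  map_add' v w := by ext; simp [mul_add]

theorem cyclicTwist_apply (σ : Φ →+* Φ) (z : Φ) (v : Fin d × ι → Φ) (u : Fin d × ι) :
    cyclicTwist d ι σ z v u = (if u.1 = 0 then z else 1) * σ (v (u.1 - 1, u.2)) := rfl

theorem Fin.val_sub_one_of_eq_zero {k : Fin d} (hk : k = 0) : (k - 1).val = d - 1 := by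
  subst hk
  obtain ⟨e, rfl⟩ : ∃ e, d = e + 1 := ⟨d - 1, by have := NeZero.ne d; omega⟩
  simp

theorem Fin.val_sub_one_of_neZero {k : Fin d} (hk : k ≠ 0) : (k - 1).val = k.val - 1 := by
  obtain ⟨e, rfl⟩ : ∃ e, d = e + 1 := ⟨d - 1, by have := NeZero.ne d; omega⟩
  exact Fin.val_sub_one_of_ne_zero hk

open Fin.CommRing in
theorem iterate_cyclicTwist_apply {σ : Φ →+* Φ} {z : Φ} (hz : σ z = z) (v : Fin d × ι → Φ) {j : ℕ}
    (hj : j ≤ d) (u : Fin d × ι) :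
    (cyclicTwist d ι σ z)^[j] v u =
      (if u.1.val < j then z else 1) * σ^[j] (v (u.1 - (j : Fin d), u.2)) := by
  induction j generalizing u with
  | zero => simp
  | succ j ih =>
    rw [Function.iterate_succ_apply', cyclicTwist_apply, ih (by omega),
      Function.iterate_succ_apply', map_mul, ← mul_assoc]
    congr 1
    · by_cases h : u.1 = 0
      · have h1 := Fin.val_sub_one_of_eq_zero h
        simp only [h, if_true] at h1 ⊢
        rw [h1, if_neg (by omega), map_one, mul_one, if_pos (by simp)]
      · have h1 := Fin.val_sub_one_of_neZero h
        have h2 : u.1.val ≠ 0 := fun h' => h (Fin.ext h')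
        simp only [h, if_false, h1, one_mul]
        by_cases h3 : u.1.val < j + 1
        · rw [if_pos (by omega), if_pos h3, hz]
        · rw [if_neg (by omega), if_neg h3, map_one]
    · push_cast
      rw [sub_sub, add_comm (1 : Fin d)]

theorem mulVec_cyclicTwist {K μ : Type*} [Field K] [Algebra K Φ] [Fintype μ] [Fintype ι]
    {σ : Φ →+* Φ} {z : Φ} (hσ : ∀ c : K, σ (algebraMap K Φ c) = algebraMap K Φ c)
    (A : μ → Matrix ι ι K) {X : μ → Matrix (Fin d) (Fin d) Φ}
    (hX : ∀ i k l, (if k = 0 then z else 1) * σ (X i (k - 1) (l - 1)) =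
      X i k l * if l = 0 then z else 1) (v : Fin d × ι → Φ) :
    kronSum A X *ᵥ cyclicTwist d ι σ z v = cyclicTwist d ι σ z (kronSum A X *ᵥ v) := by
  ext u
  rw [cyclicTwist_apply]
  simp only [mulVec, dotProduct, map_sum, kronSum_apply, Finset.mul_sum, Finset.sum_mul, map_mul,
    cyclicTwist_apply, hσ, Fintype.sum_prod_type]
  symm
  rw [← (Equiv.subRight (1 : Fin d)).sum_comp]
  refine Finset.sum_congr rfl fun l _ => Finset.sum_congr rfl fun b _ =>
    Finset.sum_congr rfl fun i _ => ?_
  rw [Equiv.subRight_apply]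
  linear_combination (algebraMap K Φ (A i u.2 b) * σ (v (l - 1, b))) * hX i u.1 l

open Fin.CommRing in
/-- The regularity lemma: the generic rank of a `d × d` blow-up is divisible by `d`. -/
theorem dvd_genRank_self {K μ : Type*} [Field K] [Fintype μ] [Fintype ι] (A : μ → Matrix ι ι K)
    (d : ℕ) [NeZero d] : d ∣ genRank A d d := by
  classical
  let S := MvPolynomial (μ × Fin d × Fin d) K
  let R := Polynomial S
  let Φ := FractionRing R
  let s : μ × Fin d × Fin d ≃ μ × Fin d × Fin d :=
    (Equiv.refl μ).prodCongr ((Equiv.addRight 1).prodCongr (Equiv.addRight 1))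
  let τ : S ≃ₐ[K] S := MvPolynomial.renameEquiv K s
  let ρ : R ≃+* R := Polynomial.mapEquiv τ.toRingEquiv
  let σ : Φ ≃+* Φ := IsFractionRing.ringEquivOfRingEquiv ρ
  have hσ : ∀ p : R, σ (algebraMap R Φ p) = algebraMap R Φ (p.map (τ : S →+* S)) := fun p =>
    IsFractionRing.ringEquivOfRingEquiv_algebraMap ρ p
  let x : μ → Matrix (Fin d) (Fin d) R := fun i => of fun k l =>
    Polynomial.C (MvPolynomial.X (i, k, l)) * if k < l then Polynomial.X else 1
  let N : Matrix (Fin d × ι) (Fin d × ι) R := of fun u v =>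
    ∑ i, x i u.1 v.1 * algebraMap K R (A i u.2 v.2)
  let X : μ → Matrix (Fin d) (Fin d) Φ := fun i => (x i).map (algebraMap R Φ)
  let z : Φ := algebraMap R Φ Polynomial.X
  have hNX : N.map (algebraMap R Φ) = kronSum A X := by
    ext u v
    simp [N, kronSum_apply, X, IsScalarTower.algebraMap_apply K R Φ]
  have hz : σ z = z := by simp [z, hσ]
  have hev : ∀ p : S, Polynomial.evalRingHom 1 (Polynomial.C p) = p := fun p =>
    Polynomial.eval_C
  have hrank : (kronSum A X).rank = genRank A d d := by
    refine le_antisymm (by simpa using rank_kronSum_le_genRank A X) ?_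
    rw [← hNX, genRank_eq_rank_kronSum]
    refine le_trans (le_of_eq ?_) (N.rank_map_le_rank_map
      (((algebraMap S (FractionRing S)).comp (Polynomial.evalRingHom 1))) (algebraMap R Φ)
      (IsFractionRing.injective _ _))
    congr 1
    ext u v
    simp only [kronSum_apply, of_apply, map_apply, N, map_sum, map_mul, x]
    refine Finset.sum_congr rfl fun i _ => ?_
    congr 1
    · rw [RingHom.comp_apply, RingHom.comp_apply, hev]
      split_ifs
      · rw [Polynomial.coe_evalRingHom, Polynomial.eval_X, map_one, mul_one]
      · rw [map_one, map_one, mul_one]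
    · rw [IsScalarTower.algebraMap_apply K S R, IsScalarTower.algebraMap_apply K S (FractionRing S),
        RingHom.comp_apply]
      exact congrArg _ (hev _).symm
  have hσK : ∀ c : K, σ (algebraMap K Φ c) = algebraMap K Φ c := by
    intro c
    rw [IsScalarTower.algebraMap_apply K R Φ, hσ, IsScalarTower.algebraMap_apply K S R]
    exact congrArg _ ((Polynomial.map_C _).trans (congrArg Polynomial.C (τ.commutes c)))
  have hX : ∀ i k l, (if k = 0 then z else 1) * (σ : Φ →+* Φ) (X i (k - 1) (l - 1)) =
      X i k l * if l = 0 then z else 1 := by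
    intro i k l
    have h1 : σ (algebraMap R Φ (Polynomial.C (MvPolynomial.X (i, k - 1, l - 1)))) =
        algebraMap R Φ (Polynomial.C (MvPolynomial.X (i, k, l))) := by
      rw [hσ, Polynomial.map_C]
      refine congrArg (fun p => algebraMap R Φ (Polynomial.C p)) ?_
      refine (MvPolynomial.rename_X _ _).trans ?_
      simp [s]
    have h2 : σ (algebraMap R Φ (if k - 1 < l - 1 then Polynomial.X else 1)) =
        if k - 1 < l - 1 then z else 1 := by
      split_ifs
      · exact hz
      · simp
    simp only [X, map_apply, x, of_apply, map_mul]
    change _ * (σ _ * σ _) = _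
    rw [h1, h2, apply_ite (algebraMap R Φ), map_one]
    change _ * (_ * _) = (_ * if k < l then z else 1) * _
    have h3 : (if k = 0 then z else 1) * (if k - 1 < l - 1 then z else 1) =
        (if k < l then z else 1) * if l = 0 then z else 1 := by
      simp only [Fin.lt_def]
      by_cases hk : k = 0 <;> by_cases hl : l = 0
      · simp [hk, hl]
      · have := Fin.val_sub_one_of_neZero hl
        have hl' : l.val ≠ 0 := fun h' => hl (Fin.ext h')
        rw [Fin.val_sub_one_of_eq_zero hk, this, if_pos hk, if_neg hl, if_neg (by omega), hk,
          if_pos (by rw [Fin.val_zero]; omega)]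
      · have := Fin.val_sub_one_of_neZero hk
        have hk' : k.val ≠ 0 := fun h' => hk (Fin.ext h')
        rw [Fin.val_sub_one_of_eq_zero hl, this, if_neg hk, if_pos hl, if_pos (by omega), hl,
          if_neg (by rw [Fin.val_zero]; omega)]
      · have hk' : k.val ≠ 0 := fun h' => hk (Fin.ext h')
        have hl' : l.val ≠ 0 := fun h' => hl (Fin.ext h')
        rw [Fin.val_sub_one_of_neZero hl, Fin.val_sub_one_of_neZero hk, if_neg hk, if_neg hl,
          one_mul, mul_one]
        exact if_congr (by omega) rfl rfl
    linear_combination algebraMap R Φ (Polynomial.C (MvPolynomial.X (i, k, l))) * h3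
  let T := cyclicTwist d ι (σ : Φ →+* Φ) z
  let W := LinearMap.ker (kronSum A X).mulVecLin
  have hTW : ∀ w ∈ W, T w ∈ W := by
    intro w hw
    rw [LinearMap.mem_ker, mulVecLin_apply] at hw ⊢
    rw [mulVec_cyclicTwist hσK A hX, hw, map_zero]
  have hσd : ∀ y : Φ, σ^[d] y = y := by
    have hS : ∀ p : S, τ^[d] p = p := by
      intro p
      have : ∀ j, τ^[j] p = MvPolynomial.rename s^[j] p := by
        intro j
        induction j with
        | zero => simp
        | succ j ih =>
          rw [Function.iterate_succ_apply', ih, Function.iterate_succ']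
          exact MvPolynomial.rename_rename _ _ _
      rw [this]
      have h2 : ∀ j (u : μ × Fin d × Fin d), s^[j] u = (u.1, u.2.1 + j, u.2.2 + j) := by
        intro j u
        induction j with
        | zero => simp
        | succ j ih =>
          rw [Function.iterate_succ_apply', ih]
          simp [s, add_assoc]
      have h3 : s^[d] = id := by
        ext u : 1
        rw [h2]
        simp
      rw [h3, MvPolynomial.rename_id_apply]
    have hR : ∀ p : R, σ^[d] (algebraMap R Φ p) = algebraMap R Φ p := by
      have : ∀ j (p : R), σ^[j] (algebraMap R Φ p) =
          algebraMap R Φ ((fun p : R => p.map (τ : S →+* S))^[j] p) := by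
        intro j p
        induction j with
        | zero => rfl
        | succ j ih => rw [Function.iterate_succ_apply', ih, hσ, Function.iterate_succ_apply']
      intro p
      rw [this]
      congr 1
      have h2 : ∀ j m, ((fun p : R => p.map (τ : S →+* S))^[j] p).coeff m =
          τ^[j] (p.coeff m) := by
        intro j m
        induction j with
        | zero => rfl
        | succ j ih =>
          rw [Function.iterate_succ_apply', Function.iterate_succ_apply', ← ih,
            Polynomial.coeff_map]
          rfl
      ext1 m
      rw [h2, hS]
    intro y
    obtain ⟨p, q, -, rfl⟩ := IsFractionRing.div_surjective (A := R) y
    rw [← RingEquiv.coe_toRingHom] at hR ⊢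
    rw [← RingHom.coe_pow] at hR ⊢
    rw [map_div₀, hR, hR]
  let TW : W →+ W :=
    { toFun := fun w => ⟨T w, hTW w w.2⟩
      map_zero' := Subtype.ext (map_zero T)
      map_add' := fun v w => Subtype.ext (map_add T _ _) }
  have hiter : ∀ j (w : W), ((TW^[j] w : W) : Fin d × ι → Φ) = T^[j] w := by
    intro j w
    induction j with
    | zero => rfl
    | succ j ih => rw [Function.iterate_succ_apply', Function.iterate_succ_apply', ← ih]; rfl
  have hdvd : d ∣ Module.finrank Φ W := by
    refine dvd_finrank_of_iterate_eq_smul (τ : S →+* S) τ.injective (σ : Φ →+* Φ) hσ TW ?_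
      (Nat.one_le_iff_ne_zero.2 (NeZero.ne d)) ?_
    · intro c w
      refine Subtype.ext (funext fun u => ?_)
      change (if u.1 = 0 then z else 1) * σ (c * w.1 (u.1 - 1, u.2)) =
        σ c * ((if u.1 = 0 then z else 1) * σ (w.1 (u.1 - 1, u.2)))
      rw [map_mul]
      ring
    · intro w
      refine Subtype.ext ?_
      rw [hiter]
      ext u
      rw [iterate_cyclicTwist_apply (σ := (σ : Φ →+* Φ)) hz _ le_rfl, if_pos u.1.2]
      have := hσd (w.1 (u.1 - ((d : ℕ) : Fin d), u.2))
      rw [Fin.natCast_self, sub_zero] at this ⊢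
      exact congrArg (z * ·) this
  have := finrank_ker_add_rank (kronSum A X)
  rw [hrank, Fintype.card_prod, Fintype.card_fin] at this
  exact (Nat.dvd_add_right hdvd).1 (this ▸ dvd_mul_right d _)

end Regularity

section Stability

variable {K : Type*} [Field K] {μ ι : Type*} [Fintype μ] [Fintype ι]

/-- Some square blow-up attains the maximal normalized generic rank, i.e. the non-commutative
rank. -/
theorem exists_max_genRank_self (A : μ → Matrix ι ι K) :
    ∃ r, (∀ D, genRank A D D ≤ D * r) ∧ ∃ D, 1 ≤ D ∧ genRank A D D = D * r := by
  classical
  let P : ℕ → Prop := fun c => ∃ D, 1 ≤ D ∧ genRank A D D = D * c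
  have hbound : ∀ c, P c → c ≤ Fintype.card ι := by
    rintro c ⟨D, hD, h⟩
    exact Nat.le_of_mul_le_mul_left (h ▸ genRank_le_right A D D) hD
  obtain ⟨c, hc⟩ := dvd_genRank_self A 1
  have hP : P c := ⟨1, le_rfl, hc⟩
  refine ⟨Nat.findGreatest P (Fintype.card ι), fun D => ?_, Nat.findGreatest_spec (hbound c hP) hP⟩
  rcases Nat.eq_zero_or_pos D with rfl | hD
  · rw [genRank_zero_left, zero_mul]
  · have : NeZero D := ⟨hD.ne'⟩
    obtain ⟨e, he⟩ := dvd_genRank_self A D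
    have hPe : P e := ⟨D, hD, he⟩
    rw [he]
    exact Nat.mul_le_mul_left D (Nat.le_findGreatest (hbound e hPe) hPe)

theorem genRank_self_of_succ {A : μ → Matrix ι ι K} (hA : ∀ i, (A i)ᵀ = -A i)
    (h11 : 2 ≤ genRank A 1 1) {r k : ℕ} (hk : 1 ≤ k) (hkn : Fintype.card ι ≤ k + 1)
    (hr : ∀ D, genRank A D D ≤ D * r) (h : genRank A (k + 1) (k + 1) = (k + 1) * r) :
    genRank A k k = k * r := by
  have hconc : ∀ q p, genRank A p q + genRank A (p + 2) q ≤ 2 * genRank A (p + 1) q :=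
    fun q p => genRank_add_genRank_le A p q
  have h0 : ∀ q, genRank A 0 q = 0 := genRank_zero_left A
  have h1 := mul_le_succ_mul_of_concave (h0 (k + 1)) (hconc (k + 1)) k
  have h2 := mul_le_succ_mul_of_concave (h0 k) (hconc k) k
  rw [h, genRank_comm hA k (k + 1)] at h1
  have h3 : k * r ≤ genRank A (k + 1) k := by
    refine Nat.le_of_mul_le_mul_left (c := k + 1) ?_ k.succ_pos
    linarith
  have : NeZero k := ⟨by omega⟩
  obtain ⟨c, hc⟩ := dvd_genRank_self A k
  have hrn : r ≤ Fintype.card ι :=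
    Nat.le_of_mul_le_mul_left (h ▸ genRank_le_right A (k + 1) (k + 1)) k.succ_pos
  have hcr : c ≤ r := Nat.le_of_mul_le_mul_left (hc ▸ hr k) hk
  rcases hcr.eq_or_lt with rfl | hlt
  · exact hc
  exfalso
  have h4 : k * r ≤ (k + 1) * c := by
    refine Nat.le_of_mul_le_mul_left (c := k) ?_ hk
    rw [hc] at h2
    nlinarith [Nat.mul_le_mul_left k h3]
  have hrk : r = k + 1 := by nlinarith
  have hck : c = k := by
    subst hrk
    have : k ≤ c := by nlinarith
    omega
  subst hrk hck
  have h5 := add_mul_le_of_concave (hconc c) (k := c) (c := c) (by nlinarith) hk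
  have h6 : genRank A 1 c ≤ c := by
    obtain ⟨e, rfl⟩ : ∃ e, c = e + 1 := ⟨c - 1, by omega⟩
    simp only [Nat.add_sub_cancel] at h5
    nlinarith
  have h7 := le_mul_of_concave (h0 (c + 1)) (hconc (c + 1)) (c + 1)
  rw [h] at h7
  have h8 : c + 1 ≤ genRank A 1 (c + 1) := Nat.le_of_mul_le_mul_left h7 c.succ_pos
  rw [genRank_comm hA] at h6 h8
  have h9 := add_mul_le_of_concave (hconc 1) (k := c) (c := 1) (by omega) hk
  omega

/-- Skew-symmetric pencils of order `n` have stable normalized rank from blow-up order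
`n - 1` on. -/
theorem genRank_self_eq_of_card_sub_one_le {A : μ → Matrix ι ι K} (hA : ∀ i, (A i)ᵀ = -A i)
    (h11 : 2 ≤ genRank A 1 1) {r D : ℕ} (hr : ∀ D, genRank A D D ≤ D * r) (hD1 : 1 ≤ D)
    (hD : genRank A D D = D * r) {d : ℕ} (hd1 : 1 ≤ d) (hd : Fintype.card ι - 1 ≤ d) :
    genRank A d d = d * r := by
  have hdouble : ∀ j, genRank A (2 ^ j * D) (2 ^ j * D) = 2 ^ j * D * r := by
    intro j
    induction j with
    | zero => simpa using hD
    | succ j ih =>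
      refine le_antisymm (hr _) ?_
      have := two_mul_genRank_le A (2 ^ j * D) (2 ^ j * D)
      rw [ih] at this
      rw [show 2 ^ (j + 1) * D = 2 * (2 ^ j * D) by ring]
      exact (mul_assoc 2 _ r).le.trans this
  have hdown : ∀ e, genRank A (d + e) (d + e) = (d + e) * r → genRank A d d = d * r := by
    intro e
    induction e with
    | zero => simp
    | succ e ih =>
      intro he
      exact ih (genRank_self_of_succ hA h11 (by omega) (by omega) hr he)
  have hle : d ≤ 2 ^ d * D := by nlinarith [Nat.lt_two_pow_self (n := d)]
  obtain ⟨e, he⟩ := Nat.exists_eq_add_of_le hle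
  exact hdown e (he ▸ hdouble d)

end Stability

section Perturbation

variable {F Y Z : Type*} [Field F] [AddCommGroup Y] [Module F Y] [FiniteDimensional F Y]
  [AddCommGroup Z] [Module F Z]

/-- A linearly independent family stays independent under a suitable nonzero perturbation. -/
theorem LinearIndependent.exists_ne_zero_add_smul [Infinite F] {ν : Type*} [Fintype ν] {w : ν → Z}
    (hw : LinearIndependent F w) (w' : ν → Z) :
    ∃ s : F, s ≠ 0 ∧ LinearIndependent F (w + s • w') := by
  classical
  obtain ⟨L, hL⟩ := LinearMap.exists_leftInverse_of_injective (Fintype.linearCombination F w)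
    (LinearMap.ker_eq_bot.2 (linearIndependent_iff_injective_fintypeLinearCombination.1 hw))
  have hLw : ∀ j, L (w j) = Pi.single j 1 := fun j => by
    simpa using LinearMap.congr_fun hL (Pi.single j 1)
  let G : Matrix ν ν F := of fun j => L (w' j)
  let p : Polynomial F := det (1 + (Polynomial.X : Polynomial F) • G.map Polynomial.C)
  have hp : ∀ s, p.eval s = det (1 + s • G) := by
    intro s
    rw [← Polynomial.coe_evalRingHom, RingHom.map_det]
    congr 1
    ext i j
    by_cases hij : i = j <;> simp [one_apply, hij, mul_comm s]
  have hpX : p * Polynomial.X ≠ 0 := by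
    refine mul_ne_zero (fun h => ?_) Polynomial.X_ne_zero
    have := hp 0
    simp [h] at this
  obtain ⟨s, hs⟩ : ∃ s, (p * Polynomial.X).eval s ≠ 0 := by
    by_contra! h
    exact hpX (Polynomial.funext fun s => by rw [h, Polynomial.eval_zero])
  rw [Polynomial.eval_mul, Polynomial.eval_X, hp] at hs
  refine ⟨s, right_ne_zero_of_mul hs, LinearIndependent.of_comp L ?_⟩
  have hrow : L ∘ (w + s • w') = (1 + s • G).row := by
    ext i j
    simp [hLw, G, one_apply, Pi.single_apply, eq_comm]
  rw [hrow, linearIndependent_rows_iff_isUnit, isUnit_iff_isUnit_det]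
  exact (left_ne_zero_of_mul hs).isUnit

theorem LinearMap.mem_range_of_finrank_ker_le [Infinite F] [FiniteDimensional F Z]
    {B C : Y →ₗ[F] Z}
    (h : ∀ s : F, Module.finrank F (ker B) ≤ Module.finrank F (ker (B + s • C))) {x : Y}
    (hx : B x = 0) : C x ∈ range B := by
  by_contra hCx
  obtain ⟨k, b⟩ : ∃ k, Nonempty (Module.Basis (Fin k) F (range B)) :=
    ⟨_, ⟨Module.finBasis F (range B)⟩⟩
  obtain ⟨b⟩ := b
  have hk : Module.finrank F (range B) = k := by
    rw [Module.finrank_eq_card_basis b, Fintype.card_fin]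
  choose u hu using fun j => (b j).2
  let v : Option (Fin k) → Z := fun o => o.elim (C x) fun j => B (u j)
  let v' : Option (Fin k) → Z := fun o => o.elim 0 fun j => C (u j)
  have hv : LinearIndependent F v := by
    rw [linearIndependent_option]
    have h1 : LinearIndependent F fun j => (b j : Z) :=
      b.linearIndependent.map' _ (Submodule.ker_subtype _)
    have h2 : v ∘ some = fun j => (b j : Z) := funext hu
    refine ⟨h2 ▸ h1, fun hmem => hCx ?_⟩
    refine Submodule.span_le.2 ?_ hmem
    rintro _ ⟨j, rfl⟩
    exact ⟨u j, rfl⟩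
  obtain ⟨s, hs, hli⟩ := hv.exists_ne_zero_add_smul v'
  have hmem : ∀ o, (v + s • v') o ∈ range (B + s • C) := by
    rintro (_ | j)
    · exact ⟨s⁻¹ • x, by simp [hx, smul_smul, hs, v, v']⟩
    · exact ⟨u j, rfl⟩
  have hcard : k + 1 ≤ Module.finrank F (range (B + s • C)) := by
    have hli' : LinearIndependent F fun o => (⟨_, hmem o⟩ : range (B + s • C)) :=
      LinearIndependent.of_comp (range (B + s • C)).subtype hli
    simpa using hli'.fintype_card_le_finrank
  have h1 := finrank_range_add_finrank_ker B
  have h2 := finrank_range_add_finrank_ker (B + s • C)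
  linarith [h s]

theorem LinearMap.mem_map_of_finrank_inf_ker_le [Infinite F] [FiniteDimensional F Z]
    (U : Submodule F Y) {B C : Y →ₗ[F] Z}
    (h : ∀ s : F, Module.finrank F ↥(U ⊓ ker B) ≤ Module.finrank F ↥(U ⊓ ker (B + s • C))) {x : Y}
    (hx : x ∈ U ⊓ ker B) : C x ∈ U.map B := by
  have hker : ∀ E : Y →ₗ[F] Z,
      Module.finrank F (ker (E ∘ₗ U.subtype)) = Module.finrank F ↥(U ⊓ ker E) := fun E => by
    rw [ker_comp, ← Submodule.map_comap_subtype, Submodule.finrank_map_subtype_eq]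
  have := mem_range_of_finrank_ker_le (B := B ∘ₗ U.subtype) (C := C ∘ₗ U.subtype) (x := ⟨x, hx.1⟩)
    (fun s => by
      rw [hker, ← smul_comp, ← add_comp, hker]
      exact h s) hx.2
  rwa [range_comp, Submodule.range_subtype] at this

end Perturbation

section SaturatedBlowup

variable {K : Type*} [Field K] {μ ι : Type*} [Fintype μ] [Fintype ι]

theorem genRank_le_succ (A : μ → Matrix ι ι K) (p q : ℕ) :
    genRank A p q ≤ genRank A (p + 1) q := by
  classical
  have : Infinite (FractionRing (Polynomial K)) :=
    Infinite.of_injective _ (IsFractionRing.injective (Polynomial K) (FractionRing (Polynomial K)))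
  obtain ⟨X, hX⟩ := exists_finrank_iInf_ker_blockRow (FractionRing (Polynomial K)) A (p + 1) q
  have h1 := hX Finset.univ
  have h2 := hX (Finset.univ.erase 0)
  rw [Finset.card_erase_of_mem (Finset.mem_univ _), Finset.card_univ, Fintype.card_fin,
    Nat.add_sub_cancel] at h2
  rw [Finset.card_univ, Fintype.card_fin] at h1
  have h3 := Submodule.finrank_mono (biInf_mono (f := fun k => LinearMap.ker
    (blockRow A fun i => X i k)) fun k (_ : k ∈ Finset.univ.erase (0 : Fin (p + 1))) =>
      Finset.mem_univ k)
  omega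

/-- Some blow-up order attains the maximal normalized rank and has two equal rank increments. -/
theorem exists_genRank_add_two_eq (A : μ → Matrix ι ι K) {r : ℕ}
    (hr : ∀ D, genRank A D D ≤ D * r) (hD : ∃ D, 1 ≤ D ∧ genRank A D D = D * r) :
    ∃ Q α, 1 ≤ Q ∧ genRank A Q Q = Q * r ∧ genRank A (Q + 1) Q = Q * r + α ∧
      genRank A (Q + 2) Q = Q * r + 2 * α := by
  classical
  let P : ℕ → Prop := fun α => ∃ D, 1 ≤ D ∧ genRank A D D = D * r ∧ genRank A (D + 1) D = D * r + α
  have hbound : ∀ α, P α → α ≤ r := by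
    rintro α ⟨D, hD1, h1, h2⟩
    have := mul_le_succ_mul_of_concave (genRank_zero_left A D)
      (fun p => genRank_add_genRank_le A p D) D
    rw [h1, h2] at this
    refine Nat.le_of_mul_le_mul_left (c := D) ?_ hD1
    linarith
  obtain ⟨D₀, hD₀, hD₀r⟩ := hD
  have hP₀ : P (genRank A (D₀ + 1) D₀ - D₀ * r) :=
    ⟨D₀, hD₀, hD₀r, by have := genRank_le_succ A D₀ D₀; omega⟩
  have hmax : ∀ α, P α → α ≤ Nat.findGreatest P r := fun α h => Nat.le_findGreatest (hbound α h) h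
  obtain ⟨D, hD1, h1, h2⟩ := Nat.findGreatest_spec (hbound _ hP₀) hP₀
  set α := Nat.findGreatest P r
  have h3 := two_mul_genRank_le A D D
  have h4 := two_mul_genRank_le A (D + 1) D
  have h5 := genRank_add_genRank_le A (2 * D) (2 * D)
  have h6 := hr (2 * D)
  have h7 : genRank A (2 * D) (2 * D) = 2 * D * r := by
    rw [h1, ← mul_assoc] at h3
    omega
  rw [h7] at h5
  rw [h2, mul_add, ← mul_assoc] at h4
  have h8 := hmax _ ⟨2 * D, by omega, h7, (Nat.add_sub_of_le (h7 ▸ genRank_le_succ A _ _)).symm⟩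
  refine ⟨2 * D, α, by omega, h7, ?_, ?_⟩
  · rw [show 2 * (D + 1) = 2 * D + 2 by ring] at h4
    omega
  · rw [show 2 * (D + 1) = 2 * D + 2 by ring] at h4
    omega

theorem sup_eq_of_finrank_add_finrank_inf {F Y : Type*} [Field F] [AddCommGroup Y] [Module F Y]
    [FiniteDimensional F Y] {U U₁ U₂ : Submodule F Y} (h₁ : U₁ ≤ U) (h₂ : U₂ ≤ U)
    (h : Module.finrank F U + Module.finrank F ↥(U₁ ⊓ U₂) ≤
      Module.finrank F U₁ + Module.finrank F U₂) : U₁ ⊔ U₂ = U := by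
  have := Submodule.finrank_sup_add_finrank_inf_eq U₁ U₂
  exact Submodule.eq_of_le_of_finrank_le (sup_le h₁ h₂) (by omega)

/-- There is a subspace that the pencil `A` compresses by at least `card ι - r` dimensions. -/
theorem exists_shrunk_subspace (F : Type*) [Field F] [Algebra K F] [Infinite F]
    (A : μ → Matrix ι ι K) {r : ℕ} (hr : ∀ D, genRank A D D ≤ D * r)
    (hD : ∃ D, 1 ≤ D ∧ genRank A D D = D * r) :
    ∃ V W : Submodule F (ι → F), (∀ i, ∀ v ∈ V, (A i).map (algebraMap K F) *ᵥ v ∈ W) ∧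
      Fintype.card ι + Module.finrank F W ≤ Module.finrank F V + r := by
  classical
  obtain ⟨Q, α, hQ, hg0, hg1, hg2⟩ := exists_genRank_add_two_eq A hr hD
  obtain ⟨X, hX⟩ := exists_finrank_iInf_ker_blockRow F A (Q + 2) Q
  let B : Fin (Q + 2) → (Fin Q × ι → F) →ₗ[F] (ι → F) := fun k => blockRow A fun i => X i k
  let κ : Finset (Fin (Q + 2)) → Submodule F (Fin Q × ι → F) := fun P =>
    ⨅ k ∈ P, LinearMap.ker (B k)
  have hκ : ∀ P, Module.finrank F (κ P) + genRank A P.card Q = Q * Fintype.card ι := hX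
  let S : Fin (Q + 2) → Fin (Q + 2) → Finset (Fin (Q + 2)) := fun i j =>
    (Finset.univ.erase i).erase j
  have hScard : ∀ i j, i ≠ j → (S i j).card = Q := by
    intro i j hij
    rw [Finset.card_erase_of_mem (by simp [hij.symm]), Finset.card_erase_of_mem (by simp)]
    simp
  have hinsert : ∀ i j, i ≠ j → κ (S i j) ⊓ LinearMap.ker (B j) = κ (Finset.univ.erase i) := by
    intro i j hij
    have h1 : insert j (S i j) = Finset.univ.erase i :=
      Finset.insert_erase (Finset.mem_erase.2 ⟨hij.symm, Finset.mem_univ j⟩)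
    rw [← h1, inf_comm]
    exact (Finset.iInf_insert j (S i j) fun k => LinearMap.ker (B k)).symm
  have hsymm : ∀ i j, S i j = S j i := fun i j => Finset.erase_right_comm
  have hκ1 : ∀ i, Module.finrank F (κ (Finset.univ.erase i)) + (Q * r + α) =
      Q * Fintype.card ι := by
    intro i
    have := hκ (Finset.univ.erase i)
    rwa [Finset.card_erase_of_mem (Finset.mem_univ _), Finset.card_univ, Fintype.card_fin,
      show Q + 2 - 1 = Q + 1 by omega, hg1] at this
  have hsup : ∀ i j, i ≠ j →
      κ (Finset.univ.erase i) ⊔ κ (Finset.univ.erase j) = κ (S i j) := by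
    intro i j hij
    refine sup_eq_of_finrank_add_finrank_inf (by rw [← hinsert i j hij]; exact inf_le_left)
      (by rw [← hinsert j i hij.symm, hsymm]; exact inf_le_left) ?_
    have h1 : κ (Finset.univ.erase i) ⊓ κ (Finset.univ.erase j) = κ Finset.univ := by
      refine le_antisymm (le_iInf₂ fun k _ => ?_) (le_inf ?_ ?_)
      · by_cases hk : k = i
        · exact inf_le_of_right_le (iInf₂_le k (by simp [hk, hij]))
        · exact inf_le_of_left_le (iInf₂_le k (by simp [hk]))
      · exact biInf_mono fun k _ => Finset.mem_univ k
      · exact biInf_mono fun k _ => Finset.mem_univ k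
    have h2 := hκ (S i j)
    have h3 := hκ Finset.univ
    rw [hScard i j hij, hg0] at h2
    rw [Finset.card_univ, Fintype.card_fin, hg2] at h3
    rw [h1]
    have h4 := hκ1 i
    have h5 := hκ1 j
    omega
  have hpert : ∀ i j, i ≠ j → ∀ y : μ → Fin Q → F, ∀ x ∈ κ (Finset.univ.erase i),
      blockRow A y x ∈ (κ (S i j)).map (B j) := by
    intro i j hij y x hx
    rw [← hinsert i j hij] at hx
    refine LinearMap.mem_map_of_finrank_inf_ker_le _ (fun s => ?_) hx
    have h1 := card_mul_card_le_finrank_iInf_ker_blockRow A fun m =>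
      (of fun (o : Option (S i j)) => o.elim (X m j + s • y m) fun k => X m k.1)
    rw [Fintype.card_option, Fintype.card_coe, hScard i j hij, Fintype.card_fin, hg1,
      iInf_option] at h1
    have h2 : κ (S i j) = ⨅ k : S i j, LinearMap.ker (B k) := iInf_subtype'
    have h4 : B j + s • blockRow A y = blockRow A ((fun m => X m j) + s • y) :=
      (blockRow_add_smul _ _ _ _).symm
    rw [hinsert i j hij, inf_comm, h2, h4]
    have h3 := hκ1 i
    change _ ≤ Module.finrank F ↥(LinearMap.ker (blockRow A ((fun m => X m j) + s • y)) ⊓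
      ⨅ k : S i j, LinearMap.ker (B k)) + _ at h1
    omega
  let R : Fin (Q + 2) → Submodule F (ι → F) := fun i => (κ (Finset.univ.erase i)).map (B i)
  have hvan : ∀ i j, i ≠ j → (κ (Finset.univ.erase i)).map (B j) = ⊥ := by
    intro i j hij
    rw [← hinsert i j hij, eq_bot_iff]
    rintro _ ⟨x, hx, rfl⟩
    exact hx.2
  have hR : ∀ i j, i ≠ j → (κ (S i j)).map (B i) = R i := by
    intro i j hij
    rw [← hsup i j hij, Submodule.map_sup, hvan j i hij.symm, sup_bot_eq]
  have hRle : ∀ i j, i ≠ j → R i ≤ R j := by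
    rintro i j hij _ ⟨x, hx, rfl⟩
    rw [← hR j i hij.symm, hsymm]
    exact hpert i j hij _ x hx
  let i₀ : Fin (Q + 2) := 0
  let j₀ : Fin (Q + 2) := 1
  have hi₀j₀ : i₀ ≠ j₀ := Fin.zero_ne_one
  have hRW : ∀ i, R i = R i₀ := fun i => by
    by_cases h : i = i₀
    · rw [h]
    · exact le_antisymm (hRle _ _ h) (hRle _ _ (Ne.symm h))
  have hC : ∀ i, ∀ y : μ → Fin Q → F, ∀ x ∈ κ (Finset.univ.erase i), blockRow A y x ∈ R i₀ := by
    intro i y x hx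
    obtain ⟨j, hij⟩ := exists_ne i
    have := hpert i j hij.symm y x hx
    rwa [hsymm, hR j i hij, hRW] at this
  let V : Submodule F (ι → F) :=
    ⨅ i, (R i₀).comap ((A i).map (algebraMap K F)).mulVecLin
  have hV : ∀ v, v ∈ V ↔ ∀ i, (A i).map (algebraMap K F) *ᵥ v ∈ R i₀ := fun v => by
    simp [V, Submodule.mem_iInf]
  refine ⟨V, R i₀, fun i v hv => (hV v).1 hv i, ?_⟩
  let E : Submodule F (Fin Q × ι → F) :=
    ⨅ l, V.comap (LinearMap.funLeft F F fun b => (l, b))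
  have hE : ∀ x, x ∈ E ↔ ∀ l, (fun b => x (l, b)) ∈ V := fun x => by
    simp only [E, Submodule.mem_iInf, Submodule.mem_comap]
    rfl
  have hEV : Module.finrank F E ≤ Q * Module.finrank F V := by
    let φ : E →ₗ[F] (Fin Q → V) := LinearMap.pi fun l =>
      ((LinearMap.funLeft F F fun b => (l, b)) ∘ₗ E.subtype).codRestrict V fun x =>
        (hE x).1 x.2 l
    have hφ : Function.Injective φ := by
      intro x y hxy
      ext ⟨l, b⟩
      exact congrFun (congrArg Subtype.val (congrFun hxy l)) b
    have h := LinearMap.finrank_le_finrank_of_injective hφ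
    rwa [Module.finrank_pi_fintype, Finset.sum_const, Finset.card_univ, Fintype.card_fin,
      smul_eq_mul] at h
  have hBE : ∀ x ∈ E, ∀ k, B k x ∈ R i₀ := by
    intro x hx k
    rw [blockRow_apply]
    exact Submodule.sum_mem _ fun l _ => Submodule.sum_mem _ fun i _ =>
      Submodule.smul_mem _ _ ((hV _).1 ((hE x).1 hx l) i)
  have hLE : ∀ i, κ (Finset.univ.erase i) ≤ E := by
    intro i x hx
    refine (hE x).2 fun l => (hV _).2 fun m => ?_
    have := hC i (Pi.single m (Pi.single l 1)) x hx
    rw [blockRow_apply, Finset.sum_eq_single l, Finset.sum_eq_single m] at this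
    · simpa using this
    · intro m' _ hm'
      simp [Pi.single_eq_of_ne hm']
    · simp
    · intro l' _ hl'
      refine Finset.sum_eq_zero fun m' _ => ?_
      by_cases hm' : m' = m
      · subst hm'
        simp [Pi.single_eq_of_ne hl']
      · simp [Pi.single_eq_of_ne hm']
    · simp
  let ψ : E →ₗ[F] (S i₀ j₀ → R i₀) := LinearMap.pi fun k =>
    (B k.1 ∘ₗ E.subtype).codRestrict (R i₀) fun x => hBE x x.2 k
  have hψ : LinearMap.range ψ = ⊤ := by
    rw [eq_top_iff, ← LinearMap.iSup_range_single, iSup_le_iff]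
    rintro k _ ⟨w, rfl⟩
    have hw : (w : ι → F) ∈ R k := by
      rw [hRW]
      exact w.2
    obtain ⟨x, hx, hxw⟩ := hw
    refine ⟨⟨x, hLE _ hx⟩, funext fun j => Subtype.ext ?_⟩
    change B j x = _
    by_cases hjk : j = k
    · subst hjk
      simpa using hxw
    · have h1 : B j x ∈ (κ (Finset.univ.erase k.1)).map (B j) := ⟨x, hx, rfl⟩
      rw [hvan k.1 j.1 fun h => hjk (Subtype.ext h.symm)] at h1
      simpa [Pi.single_eq_of_ne hjk] using h1
  have hker : κ (S i₀ j₀) ≤ (LinearMap.ker ψ).map E.subtype := by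
    intro x hx
    have hxE : x ∈ E := by
      rw [← hsup i₀ j₀ hi₀j₀] at hx
      exact sup_le (hLE _) (hLE _) hx
    refine ⟨⟨x, hxE⟩, funext fun k => Subtype.ext ?_, rfl⟩
    exact (Submodule.mem_iInf _).1 ((Submodule.mem_iInf _).1 hx k.1) k.2
  have h1 := Submodule.finrank_mono hker
  rw [Submodule.finrank_map_subtype_eq] at h1
  have h2 := LinearMap.finrank_range_add_finrank_ker ψ
  rw [hψ, finrank_top, Module.finrank_pi_fintype, Finset.sum_const, Finset.card_univ,
    Fintype.card_coe, hScard _ _ hi₀j₀, smul_eq_mul] at h2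
  have h3 := hκ (S i₀ j₀)
  rw [hScard _ _ hi₀j₀, hg0] at h3
  refine Nat.le_of_mul_le_mul_left (c := Q) ?_ hQ
  rw [mul_add, mul_add]
  omega

end SaturatedBlowup

section Isotropic

/-- The annihilator of a subspace with respect to the dot product. -/
def dotPerp {K ι : Type*} [Field K] [Fintype ι] (U : Submodule K (ι → K)) :
    Submodule K (ι → K) where
  carrier := {w | ∀ u ∈ U, u ⬝ᵥ w = 0}
  add_mem' hv hw u hu := by rw [dotProduct_add, hv u hu, hw u hu, add_zero]
  zero_mem' u _ := dotProduct_zero u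
  smul_mem' c w hw u hu := by rw [dotProduct_smul, hw u hu, smul_zero]

variable {K ι : Type*} [Field K] [Fintype ι]

theorem finrank_dotPerp_add_finrank (U : Submodule K (ι → K)) :
    Module.finrank K (dotPerp U) + Module.finrank K U = Fintype.card ι := by
  obtain ⟨k, ⟨b⟩⟩ : ∃ k, Nonempty (Module.Basis (Fin k) K U) := ⟨_, ⟨Module.finBasis K U⟩⟩
  have hk : Module.finrank K U = k := by rw [Module.finrank_eq_card_basis b, Fintype.card_fin]
  have hb : ∀ j, (b j : ι → K) ∈ U := fun j => (b j).2
  obtain ⟨M, hM⟩ : ∃ M : Matrix (Fin k) ι K, ∀ j, M j = b j := ⟨fun j => b j, fun _ => rfl⟩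
  have hrank : M.rank = k := by
    have h : LinearIndependent K M.row := by
      rw [show M.row = U.subtype ∘ b from funext hM]
      exact b.linearIndependent.map' _ (Submodule.ker_subtype _)
    rw [h.rank_matrix, Fintype.card_fin]
  have hker : dotPerp U = LinearMap.ker M.mulVecLin := by
    ext w
    rw [LinearMap.mem_ker, mulVecLin_apply]
    have hw : ∀ j, (M *ᵥ w) j = (b j : ι → K) ⬝ᵥ w := fun j => by rw [← hM]; rfl
    refine ⟨fun h => funext fun j => (hw j).trans (h _ (hb j)), fun h u hu => ?_⟩
    have hu' : u = ∑ j, b.repr ⟨u, hu⟩ j • (b j : ι → K) := by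
      have h := congrArg U.subtype (b.sum_repr ⟨u, hu⟩)
      rw [map_sum] at h
      exact h.symm
    rw [hu', sum_dotProduct]
    refine Finset.sum_eq_zero fun j _ => ?_
    rw [smul_dotProduct, ← hw, h, Pi.zero_apply, smul_zero]
  rw [hker, hk, ← finrank_ker_add_rank M, hrank]

theorem dotPerp_anti {U V : Submodule K (ι → K)} (h : V ≤ U) : dotPerp U ≤ dotPerp V :=
  fun _ hw v hv => hw v (h hv)

/-- Specialization at `0` of a subspace over `K(X)`. -/
theorem exists_specialization (V : Submodule (FractionRing (Polynomial K))
    (ι → FractionRing (Polynomial K))) :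
    ∃ V' : Submodule K (ι → K),
      Module.finrank (FractionRing (Polynomial K)) V ≤ Module.finrank K V' ∧
      ∀ v ∈ V', ∃ p : ι → Polynomial K,
        (fun j => algebraMap _ (FractionRing (Polynomial K)) (p j)) ∈ V ∧
        ∀ j, (p j).coeff 0 = v j := by
  classical
  set F := FractionRing (Polynomial K)
  let N : Submodule (Polynomial K) (ι → Polynomial K) :=
    (V.restrictScalars (Polynomial K)).comap ((Algebra.linearMap (Polynomial K) F).compLeft ι)
  have hN : ∀ p, p ∈ N ↔ (fun j => algebraMap _ F (p j)) ∈ V := fun p => Iff.rfl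
  let ev : (ι → Polynomial K) →ₗ[K] (ι → K) := (Polynomial.lcoeff K 0).compLeft ι
  have hev : ∀ p j, ev p j = (p j).coeff 0 := fun p j => rfl
  let V' : Submodule K (ι → K) := (N.restrictScalars K).map ev
  obtain ⟨k, w⟩ := Submodule.basisOfPid (Pi.basisFun (Polynomial K) ι) N
  refine ⟨V', ?_, ?_⟩
  · have h1 : Module.finrank F V ≤ k := by
      have hle : V ≤ Submodule.span F (Set.range fun i : Fin k =>
          fun j => algebraMap _ F ((w i : ι → Polynomial K) j)) := by
        intro v hv
        obtain ⟨q, hq⟩ := IsLocalization.exist_integer_multiples_of_finite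
          (nonZeroDivisors (Polynomial K)) v
        choose p hp using hq
        have hpN : p ∈ N := by
          rw [hN]
          have : (fun j => algebraMap _ F (p j)) = (q : Polynomial K) • v := funext hp
          rw [this, ← IsScalarTower.algebraMap_smul F]
          exact V.smul_mem _ hv
        have hv' : v = (algebraMap _ F (q : Polynomial K))⁻¹ •
            fun j => algebraMap _ F (p j) := by
          have hq0 : algebraMap _ F (q : Polynomial K) ≠ 0 :=
            IsFractionRing.to_map_ne_zero_of_mem_nonZeroDivisors q.2
          ext j
          rw [Pi.smul_apply, smul_eq_mul, hp, Algebra.smul_def, inv_mul_cancel_left₀ hq0]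
        rw [hv']
        refine Submodule.smul_mem _ _ ?_
        have hsum : (fun j => algebraMap _ F (p j)) = ∑ i, algebraMap _ F (w.repr ⟨p, hpN⟩ i) •
            fun j => algebraMap _ F ((w i : ι → Polynomial K) j) := by
          have h := congrArg Subtype.val (w.sum_repr ⟨p, hpN⟩)
          ext j
          have hj := congrFun h j
          simp only [Submodule.coe_sum, Submodule.coe_smul, Finset.sum_apply, Pi.smul_apply,
            smul_eq_mul] at hj ⊢
          rw [← hj, map_sum]
          simp only [map_mul]
        rw [hsum]
        exact Submodule.sum_mem _ fun i _ => Submodule.smul_mem _ _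
          (Submodule.subset_span ⟨i, rfl⟩)
      refine (Submodule.finrank_mono hle).trans ?_
      exact (finrank_range_le_card (R := F) fun i : Fin k => fun j =>
        algebraMap _ F ((w i : ι → Polynomial K) j)).trans_eq (Fintype.card_fin k)
    have h2 : LinearIndependent K fun i => (⟨ev (w i), _, (w i).2, rfl⟩ : V') := by
      refine LinearIndependent.of_comp V'.subtype ?_
      rw [Fintype.linearIndependent_iff]
      intro c hc i
      let p : ι → Polynomial K := ∑ i, Polynomial.C (c i) • (w i : ι → Polynomial K)
      have hpN : p ∈ N := N.sum_mem fun i _ => N.smul_mem _ (w i).2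
      have hp0 : ∀ j, (p j).coeff 0 = 0 := by
        intro j
        have hj := congrFun hc j
        simpa [p, hev, Finset.sum_apply, Polynomial.finsetSum_coeff] using hj
      choose u hu using fun j => Polynomial.X_dvd_iff.2 (hp0 j)
      have huN : u ∈ N := by
        rw [hN]
        have hX : algebraMap (Polynomial K) F Polynomial.X ≠ 0 := by
          rw [map_ne_zero_iff _ (IsFractionRing.injective _ _)]
          exact Polynomial.X_ne_zero
        have : (fun j => algebraMap _ F (u j)) = (algebraMap (Polynomial K) F Polynomial.X)⁻¹ •
            fun j => algebraMap _ F (p j) := by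
          ext j
          rw [Pi.smul_apply, hu, map_mul, smul_eq_mul, inv_mul_cancel_left₀ hX]
        rw [this]
        exact V.smul_mem _ ((hN p).1 hpN)
      have hpu : (∑ i, Polynomial.C (c i) • w i : N) =
          (Polynomial.X : Polynomial K) • (⟨u, huN⟩ : N) := by
        refine Subtype.ext (funext fun j => ?_)
        have := hu j
        simpa [p] using this
      have h3 := congrArg (fun x => w.repr x i) hpu
      simp only [w.repr_sum_self, map_smul, Finsupp.smul_apply, smul_eq_mul] at h3
      simpa using congrArg (fun x : Polynomial K => x.coeff 0) h3
    simpa using h1.trans (by simpa using h2.fintype_card_le_finrank)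
  · rintro _ ⟨p, hp, rfl⟩
    exact ⟨p, hp, fun j => rfl⟩

/-- A skew-symmetric pencil of maximal normalized rank `r` has a nested isotropic pair of total
dimension at least `2 card ι - r`. -/
theorem exists_nested_isotropic_pair {μ : Type*} [Fintype μ] {A : μ → Matrix ι ι K}
    (hA : ∀ i, (A i)ᵀ = -A i) {r : ℕ}
    (hr : ∀ D, genRank A D D ≤ D * r) (hD : ∃ D, 1 ≤ D ∧ genRank A D D = D * r) :
    ∃ U V : Submodule K (ι → K), V ≤ U ∧ (∀ i, ∀ u ∈ U, ∀ v ∈ V, u ⬝ᵥ A i *ᵥ v = 0) ∧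
      2 * Fintype.card ι ≤ Module.finrank K U + Module.finrank K V + r := by
  have : Infinite (FractionRing (Polynomial K)) :=
    Infinite.of_injective _ (IsFractionRing.injective (Polynomial K) (FractionRing (Polynomial K)))
  obtain ⟨V₁, W, hVW, hdim⟩ := exists_shrunk_subspace (FractionRing (Polynomial K)) A hr hD
  obtain ⟨V, hV, hVlift⟩ := exists_specialization V₁
  obtain ⟨U, hU, hUlift⟩ := exists_specialization (dotPerp W)
  have hW := finrank_dotPerp_add_finrank W
  have hiso : ∀ i, ∀ u ∈ U, ∀ v ∈ V, u ⬝ᵥ A i *ᵥ v = 0 := by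
    intro i u hu v hv
    obtain ⟨p, hp, hpu⟩ := hUlift u hu
    obtain ⟨q, hq, hqv⟩ := hVlift v hv
    have h0 := hp _ (hVW i _ hq)
    let φ := algebraMap (Polynomial K) (FractionRing (Polynomial K))
    have h1 : φ (p ⬝ᵥ (A i).map Polynomial.C *ᵥ q) = 0 := by
      rw [RingHom.map_dotProduct, dotProduct_comm, ← h0]
      congr 1
      ext j
      rw [Function.comp_apply, RingHom.map_mulVec, map_map]
      rfl
    rw [map_eq_zero_iff _ (IsFractionRing.injective _ _)] at h1
    have h2 := congrArg (Polynomial.constantCoeff) h1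
    rw [RingHom.map_dotProduct, map_zero] at h2
    rw [← h2]
    congr 1
    · exact (funext hpu).symm
    · ext j
      rw [Function.comp_apply, RingHom.map_mulVec, map_map]
      congr 1
      · ext a b
        simp
      · exact (funext hqv).symm
  refine ⟨U ⊔ V, U ⊓ V, inf_le_left.trans le_sup_left, ?_, ?_⟩
  · intro i u hu v hv
    obtain ⟨u₁, hu₁, v₁, hv₁, rfl⟩ := Submodule.mem_sup.1 hu
    have h1 : v₁ ⬝ᵥ A i *ᵥ v = -(v ⬝ᵥ A i *ᵥ v₁) := by
      rw [dotProduct_mulVec, ← mulVec_transpose, hA, neg_mulVec, neg_dotProduct, dotProduct_comm]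
    rw [add_dotProduct, hiso i u₁ hu₁ v hv.2, h1, hiso i v hv.1 v₁ hv₁, neg_zero, add_zero]
  · rw [Submodule.finrank_sup_add_finrank_inf_eq]
    omega

end Isotropic

section TwoCover

theorem rank_add_le_add_rank {F ι κ : Type*} [Field F] [Finite ι] [Fintype κ]
    (A B : Matrix ι κ F) : (A + B).rank ≤ A.rank + B.rank := by
  have h : LinearMap.range (A + B).mulVecLin ≤
      LinearMap.range A.mulVecLin ⊔ LinearMap.range B.mulVecLin := by
    rintro _ ⟨v, rfl⟩
    rw [mulVecLin_apply, add_mulVec]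
    exact Submodule.add_mem_sup ⟨v, rfl⟩ ⟨v, rfl⟩
  exact (Submodule.finrank_mono h).trans (Submodule.finrank_add_le_finrank_add_finrank _ _)

/-- If every `Aᵢ` is of the form `P * Gᵢ + Hᵢ * Q`, then the rank of `∑ Xᵢ ⊗ Aᵢ` is bounded by the
inner dimensions of the two products. -/
theorem rank_kronSum_le_of_factor {K μ ι F p q s t : Type*} [Field K] [Fintype μ] [Fintype ι]
    [Field F] [Algebra K F] [Fintype p] [Fintype q] [Fintype s] [Fintype t]
    {A : μ → Matrix ι ι K} (P : Matrix ι s K) (Q : Matrix t ι K)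
    (hA : ∀ i, ∃ (G : Matrix s ι K) (H : Matrix ι t K), A i = P * G + H * Q)
    (X : μ → Matrix p q F) :
    (kronSum A X).rank ≤ Fintype.card p * Fintype.card s + Fintype.card q * Fintype.card t := by
  classical
  choose G H hGH using hA
  let f := algebraMap K F
  have h : kronSum A X =
      kroneckerMap (· * ·) (1 : Matrix p p F) (P.map f) *
        ∑ i, kroneckerMap (· * ·) (X i) ((G i).map f) +
      (∑ i, kroneckerMap (· * ·) (X i) ((H i).map f)) *
        kroneckerMap (· * ·) (1 : Matrix q q F) (Q.map f) := by
    rw [kronSum, Matrix.mul_sum, Matrix.sum_mul, ← Finset.sum_add_distrib]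
    refine Finset.sum_congr rfl fun i _ => ?_
    have h1 := mul_kronecker_mul (1 : Matrix p p F) (X i) (P.map f) ((G i).map f)
    have h2 := mul_kronecker_mul (X i) (1 : Matrix q q F) ((H i).map f) (Q.map f)
    rw [Matrix.one_mul] at h1
    rw [Matrix.mul_one] at h2
    have h3 : (A i).map f = P.map f * (G i).map f + (H i).map f * Q.map f := by
      rw [← Matrix.map_mul, ← Matrix.map_mul, hGH, Matrix.map_add f (map_add f)]
    rw [← h1, ← h2, ← kroneckerMap_add_right _ mul_add, ← h3]
  rw [h]
  refine (rank_add_le_add_rank _ _).trans (add_le_add ?_ ?_)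
  · refine (rank_mul_le_left _ _).trans ((rank_le_card_width _).trans ?_)
    rw [Fintype.card_prod]
  · refine (rank_mul_le_right _ _).trans ((rank_le_card_height _).trans ?_)
    rw [Fintype.card_prod]

variable {K : Type*} [Field K] {n : ℕ}

theorem transpose_wedge (a b : Fin n → K) : (wedge a b)ᵀ = -wedge a b := by
  simp [wedge, transpose_vecMulVec]

theorem wedge_apply_self (a b : Fin n → K) (i : Fin n) : wedge a b i i = 0 := by
  simp [wedge, vecMulVec_apply, mul_comm]

theorem wedge_ne_zero {a b : Fin n → K} (hab : LinearIndependent K ![a, b]) : wedge a b ≠ 0 := by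
  intro h
  rw [LinearIndependent.pair_iff] at hab
  have hb : ∀ i, b i = 0 := fun i => by
    have := hab (b i) (-a i) (by
      ext j
      have := congrFun (congrFun h i) j
      simp only [wedge, Matrix.sub_apply, vecMulVec_apply, Matrix.zero_apply] at this
      simp only [Pi.add_apply, Pi.smul_apply, smul_eq_mul, Pi.zero_apply]
      linear_combination -this)
    exact this.1
  have := (hab 0 1 (by ext j; simp [hb])).2
  exact one_ne_zero this

theorem finrank_line {a b : Fin n → K} (hab : LinearIndependent K ![a, b]) :
    Module.finrank K (line a b) = 2 := by
  have := finrank_span_eq_card hab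
  rwa [Matrix.range_cons, Matrix.range_cons, Matrix.range_empty, Set.union_empty,
    Fintype.card_fin] at this

theorem dotProduct_wedge_mulVec (a b u v : Fin n → K) :
    u ⬝ᵥ wedge a b *ᵥ v = (u ⬝ᵥ a) * (v ⬝ᵥ b) - (u ⬝ᵥ b) * (v ⬝ᵥ a) := by
  rw [wedge, sub_mulVec, dotProduct_sub, vecMulVec_mulVec, vecMulVec_mulVec]
  simp only [op_smul_eq_smul, dotProduct_smul, smul_eq_mul, dotProduct_comm v]
  ring

/-- The annihilators of a nested isotropic pair form a nested 2-cover. -/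
theorem two_le_finrank_dotPerp_inf_line {a b : Fin n → K} (hab : LinearIndependent K ![a, b])
    {U V : Submodule K (Fin n → K)} (hVU : V ≤ U)
    (h : ∀ u ∈ U, ∀ v ∈ V, u ⬝ᵥ wedge a b *ᵥ v = 0) :
    2 ≤ Module.finrank K ↥(dotPerp U ⊓ line a b) + Module.finrank K ↥(dotPerp V ⊓ line a b) := by
  have ha : a ∈ line a b := Submodule.subset_span (by simp)
  have hb : b ∈ line a b := Submodule.subset_span (by simp)
  by_cases hV : ∀ v ∈ V, v ⬝ᵥ a = 0 ∧ v ⬝ᵥ b = 0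
  · have hle : line a b ≤ dotPerp V := by
      refine Submodule.span_le.2 ?_
      rintro _ (rfl | rfl)
      · exact fun v hv => (hV v hv).1
      · exact fun v hv => (hV v hv).2
    rw [inf_eq_right.2 hle, finrank_line hab]
    omega
  · push Not at hV
    obtain ⟨v, hv, hne⟩ := hV
    let c := (v ⬝ᵥ b) • a + (-(v ⬝ᵥ a)) • b
    have hc0 : c ≠ 0 := by
      intro hc
      have := LinearIndependent.pair_iff.1 hab _ _ hc
      exact hne (neg_eq_zero.1 this.2) this.1
    have hcU : c ∈ dotPerp U := by
      intro u hu
      have := h u hu v hv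
      rw [dotProduct_wedge_mulVec] at this
      rw [dotProduct_add, dotProduct_smul, dotProduct_smul, smul_eq_mul, smul_eq_mul]
      linear_combination this
    have hcl : c ∈ line a b :=
      Submodule.add_mem _ (Submodule.smul_mem _ _ ha) (Submodule.smul_mem _ _ hb)
    have h1 : 1 ≤ Module.finrank K ↥(dotPerp U ⊓ line a b) :=
      Submodule.one_le_finrank_iff.2 ((Submodule.ne_bot_iff _).2 ⟨c, ⟨hcU, hcl⟩, hc0⟩)
    have h2 := Submodule.finrank_mono (inf_le_inf_right (line a b) (dotPerp_anti hVU))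
    omega

theorem exists_wedge_eq_of_mem_line {a b c : Fin n → K} (hc : c ∈ line a b) (hc0 : c ≠ 0) :
    ∃ e, wedge a b = vecMulVec c e - vecMulVec e c := by
  obtain ⟨α, β, rfl⟩ := Submodule.mem_span_pair.1 hc
  by_cases hα : α = 0
  · have hβ : β ≠ 0 := by
      rintro rfl
      exact hc0 (by simp [hα])
    refine ⟨-β⁻¹ • a, ?_⟩
    ext i j
    simp only [wedge, Matrix.sub_apply, vecMulVec_apply, Pi.add_apply, Pi.smul_apply, smul_eq_mul,
      hα]
    field_simp
    ring
  · refine ⟨α⁻¹ • b, ?_⟩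
    ext i j
    simp only [wedge, Matrix.sub_apply, vecMulVec_apply, Pi.add_apply, Pi.smul_apply, smul_eq_mul]
    field_simp
    ring

theorem exists_mulVec_eq_of_mem (S : Submodule K (Fin n → K)) :
    ∃ P : Matrix (Fin n) (Fin (Module.finrank K S)) K, ∀ x ∈ S, ∃ y, x = P *ᵥ y := by
  let b := Module.finBasis K S
  refine ⟨of fun i j => (b j : Fin n → K) i, fun x hx => ⟨b.repr ⟨x, hx⟩, ?_⟩⟩
  have := congrArg Subtype.val (b.sum_repr ⟨x, hx⟩)
  ext i
  have hi := congrFun this i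
  simp only [Submodule.coe_sum, Submodule.coe_smul, Finset.sum_apply, Pi.smul_apply,
    smul_eq_mul] at hi
  rw [← hi]
  simp [mulVec, dotProduct, mul_comm]

/-- Every nested 2-cover bounds the rank of all blow-ups. -/
theorem rank_kronSum_wedge_le {m : ℕ} {a b : Fin m → Fin n → K}
    (hab : ∀ i, LinearIndependent K ![a i, b i]) {S T : Submodule K (Fin n → K)} (hST : S ≤ T)
    (hcover : ∀ i, 2 ≤ Module.finrank K ↥(S ⊓ line (a i) (b i)) +
      Module.finrank K ↥(T ⊓ line (a i) (b i)))
    {F : Type*} [Field F] [Algebra K F] {d : ℕ} (X : Fin m → Matrix (Fin d) (Fin d) F) :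
    (kronSum (fun i => wedge (a i) (b i)) X).rank ≤
      d * (Module.finrank K S + Module.finrank K T) := by
  obtain ⟨P, hP⟩ := exists_mulVec_eq_of_mem S
  obtain ⟨Q, hQ⟩ := exists_mulVec_eq_of_mem T
  have hleft : ∀ x ∈ S, ∀ y : Fin n → K,
      ∃ G : Matrix (Fin (Module.finrank K S)) (Fin n) K, vecMulVec x y = P * G := by
    intro x hx y
    obtain ⟨z, rfl⟩ := hP x hx
    exact ⟨vecMulVec z y, by rw [mul_vecMulVec]⟩
  have hright : ∀ x : Fin n → K, ∀ y ∈ T,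
      ∃ H : Matrix (Fin n) (Fin (Module.finrank K T)) K, vecMulVec x y = H * Qᵀ := by
    intro x y hy
    obtain ⟨z, rfl⟩ := hQ y hy
    exact ⟨vecMulVec x z, by rw [vecMulVec_mul, vecMul_transpose]⟩
  have hrank := rank_kronSum_le_of_factor (A := fun i => wedge (a i) (b i)) P Qᵀ (fun i => ?_) X
  · rwa [Fintype.card_fin, Fintype.card_fin, Fintype.card_fin, ← mul_add] at hrank
  have hfull : ∀ W : Submodule K (Fin n → K),
      2 ≤ Module.finrank K ↥(W ⊓ line (a i) (b i)) → a i ∈ W ∧ b i ∈ W := by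
    intro W hW
    have heq : W ⊓ line (a i) (b i) = line (a i) (b i) :=
      Submodule.eq_of_le_of_finrank_le inf_le_right (by rwa [finrank_line (hab i)])
    have hle := inf_eq_right.1 heq
    exact ⟨hle (Submodule.subset_span (by simp)), hle (Submodule.subset_span (by simp))⟩
  have hi := hcover i
  by_cases hS : Module.finrank K ↥(S ⊓ line (a i) (b i)) = 0
  · obtain ⟨haT, hbT⟩ := hfull T (by omega)
    obtain ⟨H₁, h₁⟩ := hright (a i) (b i) hbT
    obtain ⟨H₂, h₂⟩ := hright (b i) (a i) haT
    exact ⟨0, H₁ - H₂, by rw [wedge, h₁, h₂, Matrix.mul_zero, zero_add, Matrix.sub_mul]⟩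
  · obtain ⟨c, hc, hc0⟩ := (Submodule.ne_bot_iff _).1
      (Submodule.one_le_finrank_iff.1 (Nat.one_le_iff_ne_zero.2 hS))
    obtain ⟨e, he⟩ := exists_wedge_eq_of_mem_line hc.2 hc0
    obtain ⟨G, hG⟩ := hleft c hc.1 e
    obtain ⟨H, hH⟩ := hright e c (hST hc.1)
    exact ⟨G, -H, by rw [he, hG, hH, Matrix.neg_mul, sub_eq_add_neg]⟩

theorem rank_blowup_eq_genRank {m : ℕ} (a b : Fin m → Fin n → K) (d : ℕ) :
    (blowup a b d).rank = genRank (fun i => wedge (a i) (b i)) d d := by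
  rw [genRank_eq_rank_kronSum]
  rfl

end TwoCover

/-- For `d ≥ n − 1`, the rank of the `d`-th blow-up of the matrix representation equals
`d` times the minimum of `dim S + dim T` over all nested 2-covers `(S, T)` of the lines. -/
theorem rank_blowup_eq_d_mul_min_nested_two_cover
    {K : Type*} [Field K] {n m : ℕ} (hn : 0 < n) (hm : 0 < m)
    (a b : Fin m → Fin n → K) (hab : ∀ i, LinearIndependent K ![a i, b i])
    (d : ℕ) (hd1 : 1 ≤ d) (hd : n - 1 ≤ d) :
    (blowup a b d).rank =
      d * sInf {r : ℕ | ∃ S T : Submodule K (Fin n → K), S ≤ T ∧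
        (∀ i, 2 ≤ Module.finrank K ↥(S ⊓ line (a i) (b i)) +
          Module.finrank K ↥(T ⊓ line (a i) (b i))) ∧
        r = Module.finrank K ↥S + Module.finrank K ↥T} := by
  set A : Fin m → Matrix (Fin n) (Fin n) K := fun i => wedge (a i) (b i)
  have hA : ∀ i, (A i)ᵀ = -A i := fun i => transpose_wedge _ _
  have h11 : 2 ≤ genRank A 1 1 := two_le_genRank_one_one hA
    (fun i => wedge_apply_self _ _) ⟨0, hm⟩ (wedge_ne_zero (hab _))
  obtain ⟨r, hr, D, hD1, hD⟩ := exists_max_genRank_self A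
  have hgd : genRank A d d = d * r :=
    genRank_self_eq_of_card_sub_one_le hA h11 hr hD1 hD hd1 (by rwa [Fintype.card_fin])
  obtain ⟨U, V, hVU, hiso, hdim⟩ := exists_nested_isotropic_pair hA hr ⟨D, hD1, hD⟩
  obtain ⟨S, T, hST, hcover, hS, hT⟩ : ∃ S T : Submodule K (Fin n → K), S ≤ T ∧
      (∀ i, 2 ≤ Module.finrank K ↥(S ⊓ line (a i) (b i)) +
        Module.finrank K ↥(T ⊓ line (a i) (b i))) ∧
      Module.finrank K S + Module.finrank K U = Fintype.card (Fin n) ∧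
      Module.finrank K T + Module.finrank K V = Fintype.card (Fin n) :=
    ⟨dotPerp U, dotPerp V, dotPerp_anti hVU,
      fun i => two_le_finrank_dotPerp_inf_line (hab i) hVU (hiso i),
      finrank_dotPerp_add_finrank U, finrank_dotPerp_add_finrank V⟩
  rw [rank_blowup_eq_genRank, hgd]
  congr 1
  refine le_antisymm (le_csInf ⟨_, S, T, hST, hcover, rfl⟩ ?_) ?_
  · rintro _ ⟨S', T', hST', hcover', rfl⟩
    refine Nat.le_of_mul_le_mul_left (c := d) ?_ hd1
    rw [← hgd, genRank_eq_rank_kronSum]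
    exact rank_kronSum_wedge_le hab hST' hcover' _
  · refine le_trans (Nat.sInf_le ⟨S, T, hST, hcover, rfl⟩) ?_
    rw [Fintype.card_fin] at hS hT hdim
    omega
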